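/- arXiv:1904.12001 — 4 statements merged into one kernel-verified Lean document; each statement's English description precedes it below -/
import Mathlib

section
/- Let ξ ∈ ℝ with |ξ| > α, and let u ∈ C²([0,R)) be the solution of the Cauchy problem M⁺(u'') + g(u) = 0, u(0) = ξ, u'(0) = 0 on its maximal interval of existence [0,R). Then |u| is strictly increasing on (0,R) and |u(r)| → +∞ as r → R⁻. -/
open Set Filter Topology

/-- Local existence for an autonomous ODE with a locally Lipschitz vector field. -/
theorem LocallyLipschitz.exists_hasDerivAt_Ioo {E : Type*} [NormedAddCommGroup E]
    [NormedSpace ℝ E] [CompleteSpace E] {X : E → E} (hX : LocallyLipschitz X) (x₀ : E) (t₀ : ℝ) :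
    ∃ γ : ℝ → E, γ t₀ = x₀ ∧ ∃ ε > (0 : ℝ),
      ∀ t ∈ Ioo (t₀ - ε) (t₀ + ε), HasDerivAt γ (X (γ t)) t := by
  obtain ⟨K, s, hs, hl⟩ := hX x₀
  obtain ⟨a, ha, has⟩ := Metric.nhds_basis_closedBall.mem_iff.1 hs
  have hl' := hl.mono has
  set L : ℝ := K * a + ‖X x₀‖ + 1 with hL
  have hL0 : 0 < L := by positivity
  have hb : ∀ x ∈ Metric.closedBall x₀ a, ‖X x‖ ≤ L := fun x hx => by
    have h1 : ‖X x - X x₀‖ ≤ K * ‖x - x₀‖ :=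
      hl'.norm_sub_le hx (Metric.mem_closedBall_self ha.le)
    have h2 : K * ‖x - x₀‖ ≤ K * a := by
      gcongr
      exact mem_closedBall_iff_norm.1 hx
    linarith [norm_le_norm_sub_add (X x) (X x₀)]
  have hε : 0 < a / L := by positivity
  have hpl : IsPicardLindelof (fun _ ↦ X) (tmin := t₀ - a / L) (tmax := t₀ + a / L)
      ⟨t₀, by simp [hε.le]⟩ x₀ (.mk a ha.le) 0 (.mk L hL0.le) K := by
    refine .of_time_independent hb hl' ?_
    simp only [add_sub_cancel_left, sub_sub_cancel, max_self, NNReal.coe_mk, NNReal.coe_zero,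
      sub_zero]
    exact (mul_div_cancel₀ a hL0.ne').le
  obtain ⟨γ, h0, hγ⟩ := hpl.exists_eq_forall_mem_Icc_hasDerivWithinAt₀
  exact ⟨γ, h0, a / L, hε, fun t ht =>
    (hγ t (Ioo_subset_Icc_self ht)).hasDerivAt (Icc_mem_nhds ht.1 ht.2)⟩

/-- A solution of an autonomous ODE having a limit at the right endpoint of its interval extends
past that endpoint. -/
theorem LocallyLipschitz.exists_hasDerivAt_extension {E : Type*} [NormedAddCommGroup E]
    [NormedSpace ℝ E] [CompleteSpace E] {X : E → E} (hX : LocallyLipschitz X) {z : ℝ → E}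
    {a b : ℝ} (hab : a < b) {z₀ : E} (hz : ∀ t ∈ Ioo a b, HasDerivAt z (X (z t)) t)
    (hlim : Tendsto z (𝓝[<] b) (𝓝 z₀)) :
    ∃ ζ : ℝ → E, EqOn ζ z (Iio b) ∧ ζ b = z₀ ∧ ∃ ε > (0 : ℝ),
      ∀ t ∈ Ioo a (b + ε), HasDerivAt ζ (X (ζ t)) t := by
  classical
  obtain ⟨γ, hγ0, ε, hε, hγ⟩ := hX.exists_hasDerivAt_Ioo z₀ b
  set ζ : ℝ → E := (Iio b).piecewise z γ with hζ
  have hl : EqOn ζ z (Iio b) := piecewise_eqOn _ _ _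
  have hr : EqOn ζ γ (Ici b) := fun t ht => piecewise_eq_of_notMem _ _ _ (notMem_Iio.2 ht)
  have hb : ζ b = z₀ := (hr self_mem_Ici).trans hγ0
  refine ⟨ζ, hl, hb, ε, hε, fun t ht => ?_⟩
  rcases lt_trichotomy t b with h | rfl | h
  · rw [hl h]
    exact (hz t ⟨ht.1, h⟩).congr_of_eventuallyEq (hl.eventuallyEq_of_mem (Iio_mem_nhds h))
  · have hright : HasDerivWithinAt ζ (X (ζ t)) (Ici t) t := by
      rw [hb, ← hγ0]
      exact (hγ t ⟨by linarith, by linarith⟩).hasDerivWithinAt.congr hr (hr self_mem_Ici)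
    have hζlim : Tendsto ζ (𝓝[<] t) (𝓝 (ζ t)) := by
      rw [hb]
      exact hlim.congr' (hl.symm.eventuallyEq_of_mem self_mem_nhdsWithin)
    have hd : ∀ s ∈ Ioo a t, HasDerivAt ζ (X (ζ s)) s := fun s hs => by
      rw [hl hs.2]
      exact (hz s hs).congr_of_eventuallyEq (hl.eventuallyEq_of_mem (Iio_mem_nhds hs.2))
    have hleft : HasDerivWithinAt ζ (X (ζ t)) (Iic t) t := by
      refine hasDerivWithinAt_Iic_of_tendsto_deriv (s := Ioo a t)
        (fun s hs => (hd s hs).differentiableAt.differentiableWithinAt)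
        (hζlim.mono_left (nhdsWithin_mono _ Ioo_subset_Iio_self)) (Ioo_mem_nhdsLT hab) ?_
      refine ((hX.continuous.tendsto _).comp hζlim).congr' ?_
      filter_upwards [Ioo_mem_nhdsLT hab] with s hs using (hd s hs).deriv.symm
    simpa using hleft.union hright
  · rw [hr h.le]
    exact (hγ t ⟨by linarith, ht.2⟩).congr_of_eventuallyEq
      (hr.eventuallyEq_of_mem (Ici_mem_nhds h))

/-- A function starting above `α` with zero slope, and convex as long as it exceeds `α`, stays above
`α` and is strictly increasing, as is its derivative. -/
theorem strictMonoOn_of_convex_while_gt {D : Set ℝ} (hD : Convex ℝ D) (hD0 : 0 ∈ D)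
    (hDnn : D ⊆ Ici 0) {w w₁ : ℝ → ℝ} {α : ℝ} (hw : ContinuousOn w D) (hw₁ : ContinuousOn w₁ D)
    (h0 : α < w 0) (h0' : w₁ 0 = 0) (hd : ∀ r ∈ D, 0 < r → HasDerivAt w (w₁ r) r)
    (hd₁ : ∀ r ∈ D, 0 < r → α < w r → 0 < deriv w₁ r) :
    (∀ r ∈ D, α < w r) ∧ StrictMonoOn w D ∧ StrictMonoOn w₁ D := by
  have key : ∀ I ⊆ D, Convex ℝ I → 0 ∈ I → (∀ r ∈ interior I, α < w r) →
      StrictMonoOn w I ∧ StrictMonoOn w₁ I := fun I hI hIc hI0 hgt => by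
    have hpos : ∀ r ∈ interior I, 0 < r := fun r hr => by
      have := interior_mono (hI.trans hDnn) hr
      rwa [interior_Ici] at this
    have h₁ : StrictMonoOn w₁ I := strictMonoOn_of_deriv_pos hIc (hw₁.mono hI) fun r hr =>
      hd₁ r (hI (interior_subset hr)) (hpos r hr) (hgt r hr)
    refine ⟨strictMonoOn_of_deriv_pos hIc (hw.mono hI) fun r hr => ?_, h₁⟩
    rw [(hd r (hI (interior_subset hr)) (hpos r hr)).deriv, ← h0']
    exact h₁ hI0 (interior_subset hr) (hpos r hr)
  have hgt : ∀ r ∈ D, α < w r := by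
    by_contra! ⟨r, hrD, hr⟩
    have hsub : Icc 0 r ⊆ D := hD.ordConnected.out hD0 hrD
    have hcl : IsClosed (Icc 0 r ∩ w ⁻¹' Iic α) :=
      (hw.mono hsub).preimage_isClosed_of_isClosed isClosed_Icc isClosed_Iic
    have hcpt : IsCompact (Icc 0 r ∩ w ⁻¹' Iic α) :=
      isCompact_Icc.of_isClosed_subset hcl inter_subset_left
    obtain ⟨c, ⟨hc, hcα⟩, hmin⟩ := hcpt.exists_isLeast ⟨r, ⟨hDnn hrD, le_rfl⟩, hr⟩
    have hc0 : 0 < c := hc.1.lt_of_ne (by rintro rfl; exact hcα.not_gt h0)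
    have hcD : Icc 0 c ⊆ D := (Icc_subset_Icc_right hc.2).trans hsub
    have hm := (key (Icc 0 c) hcD (convex_Icc 0 c) ⟨le_rfl, hc0.le⟩ fun s hs => by
      rw [interior_Icc] at hs
      by_contra! hle
      exact (hmin ⟨⟨hs.1.le, hs.2.le.trans hc.2⟩, hle⟩).not_gt hs.2).1
    exact hcα.not_gt (h0.trans (hm ⟨le_rfl, hc0.le⟩ ⟨hc0.le, le_rfl⟩ hc0))
  exact ⟨hgt, key D Subset.rfl hD hD0 fun r hr => hgt r (interior_subset hr)⟩

/-- A bounded increasing solution of `w'' = f(w)`, with `w'` increasing, on a bounded interval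
extends past the right endpoint. -/
theorem exists_extension_of_bounded {f : ℝ → ℝ} (hf : LocallyLipschitz f) {w w₁ : ℝ → ℝ}
    {α b B : ℝ} (hb : 0 < b) (hgt : ∀ r ∈ Ico 0 b, α < w r) (hB : ∀ r ∈ Ico 0 b, w r ≤ B)
    (hw₁ : ContinuousOn w₁ (Ico 0 b)) (hm : StrictMonoOn w (Ico 0 b))
    (hm₁ : StrictMonoOn w₁ (Ico 0 b))
    (hd : ∀ r ∈ Ioo 0 b, HasDerivAt w (w₁ r) r) (hd₁ : ∀ r ∈ Ioo 0 b, HasDerivAt w₁ (f (w r)) r) :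
    ∃ ε > (0 : ℝ), ∃ v v₁ : ℝ → ℝ, EqOn v w (Iio b) ∧ (∀ r ∈ Ico 0 (b + ε), α < v r) ∧
      ∀ r ∈ Ioo 0 (b + ε), HasDerivAt v (v₁ r) r ∧ HasDerivAt v₁ (f (v r)) r := by
  have hne : (Ioo 0 b).Nonempty := nonempty_Ioo.2 hb
  have hbdd : BddAbove (w '' Ioo 0 b) :=
    ⟨B, forall_mem_image.2 fun r hr => hB r (Ioo_subset_Ico_self hr)⟩
  obtain ⟨C, hC⟩ := (isCompact_Icc.image hf.continuous).bddAbove (s := f '' Icc α B)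
  have hbdd₁ : BddAbove (w₁ '' Ioo 0 b) := by
    refine ⟨w₁ 0 + |C| * b, forall_mem_image.2 fun r hr => ?_⟩
    have hle := (convex_Ico 0 b).image_sub_le_mul_sub_of_deriv_le hw₁ (C := |C|) (by
      rw [interior_Ico]
      exact fun s hs => (hd₁ s hs).differentiableAt.differentiableWithinAt) (by
      rw [interior_Ico]
      intro s hs
      rw [(hd₁ s hs).deriv]
      have hs' := Ioo_subset_Ico_self hs
      exact (hC (mem_image_of_mem f ⟨(hgt s hs').le, hB s hs'⟩)).trans (le_abs_self C))
      0 ⟨le_rfl, hb⟩ r (Ioo_subset_Ico_self hr) hr.1.le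
    nlinarith [abs_nonneg C, hr.2]
  have hlim := (hm.monotoneOn.mono Ioo_subset_Ico_self).tendsto_nhdsWithin_Ioo_left hne hbdd
  have hlim₁ := (hm₁.monotoneOn.mono Ioo_subset_Ico_self).tendsto_nhdsWithin_Ioo_left hne hbdd₁
  have hX : LocallyLipschitz fun p : ℝ × ℝ => (p.2, f p.1) :=
    LipschitzWith.prod_snd.locallyLipschitz.prodMk
      (hf.comp LipschitzWith.prod_fst.locallyLipschitz)
  obtain ⟨ζ, hζ, hζb, δ, hδ, hζd⟩ := hX.exists_hasDerivAt_extension hb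
    (z := fun r => (w r, w₁ r)) (fun r hr => (hd r hr).prodMk (hd₁ r hr)) (hlim.prodMk_nhds hlim₁)
  have hbgt : α < (ζ b).1 := by
    have hmem : b / 2 ∈ Ioo 0 b := ⟨by linarith, by linarith⟩
    rw [hζb]
    exact (hgt _ (Ioo_subset_Ico_self hmem)).trans_le (le_csSup hbdd (mem_image_of_mem w hmem))
  have hcont : ContinuousAt (fun r => (ζ r).1) b :=
    (hζd b ⟨hb, by linarith⟩).continuousAt.fst
  obtain ⟨η, hη, hηgt⟩ := Metric.eventually_nhds_iff.1 (hcont.eventually_const_lt hbgt)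
  refine ⟨min δ η, lt_min hδ hη, fun r => (ζ r).1, fun r => (ζ r).2,
    fun r hr => congrArg Prod.fst (hζ hr), fun r hr => ?_, fun r hr => ?_⟩
  · rcases lt_or_ge r b with h | h
    · simpa only [hζ h] using hgt r ⟨hr.1, h⟩
    · refine hηgt ?_
      rw [Real.dist_eq, abs_of_nonneg (sub_nonneg.2 h)]
      linarith [hr.2, min_le_right δ η]
  · have h := hζd r ⟨hr.1, hr.2.trans_le (by gcongr; exact min_le_left _ _)⟩
    exact ⟨(hasFDerivAt_fst (𝕜 := ℝ) (p := ζ r)).comp_hasDerivAt r h,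
      (hasFDerivAt_snd (𝕜 := ℝ) (p := ζ r)).comp_hasDerivAt r h⟩

/-- Monotonicity and blow-up for a maximal solution of `M(u'') + g(u) = 0` when, with `σ = ±1`, the
equation reads `μ w'' + g(w) = 0` for `w = σ u` in the region `w > α`. -/
theorem strictMonoOn_abs_and_tendsto_of_maximal {M g : ℝ → ℝ} {α σ μ ξ : ℝ}
    (hg : LocallyLipschitz g) (hα : 0 < α) (hgneg : ∀ t, α < t → g t < 0) (hσ : σ * σ = 1)
    (hμ : 0 < μ) (hM : ∀ t d, α < t → (M (σ * d) + g (σ * t) = 0 ↔ μ * d + g t = 0))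
    (hξ : α < σ * ξ) {R : EReal} (hR : 0 < R) {u : ℝ → ℝ}
    (hu : ContDiffOn ℝ 2 u {r : ℝ | 0 ≤ r ∧ (r : EReal) < R})
    (hode : ∀ r : ℝ, 0 ≤ r → (r : EReal) < R → M (deriv (deriv u) r) + g (u r) = 0)
    (hu0 : u 0 = ξ) (hu'0 : deriv u 0 = 0)
    (hmax : ¬ ∃ (R' : EReal) (v : ℝ → ℝ), R < R' ∧
      ContDiffOn ℝ 2 v {r : ℝ | 0 ≤ r ∧ (r : EReal) < R'} ∧
      (∀ r : ℝ, 0 ≤ r → (r : EReal) < R' → M (deriv (deriv v) r) + g (v r) = 0) ∧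
      v 0 = ξ ∧ deriv v 0 = 0 ∧ (∀ r : ℝ, 0 ≤ r → (r : EReal) < R → v r = u r)) :
    StrictMonoOn (fun r => |u r|) {r : ℝ | 0 < r ∧ (r : EReal) < R} ∧
    Tendsto (fun r => |u r|) (comap (fun r : ℝ => (r : EReal)) (𝓝[<] R)) atTop := by
  set S : Set ℝ := {r : ℝ | 0 ≤ r ∧ (r : EReal) < R} with hS
  have hσσ : ∀ x, σ * (σ * x) = x := fun x => by rw [← mul_assoc, hσ, one_mul]
  have hode' : ∀ r ∈ S, α < σ * u r → deriv (deriv u) r = σ * (-g (σ * u r) / μ) := by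
    intro r hr hgt
    have h := (hM (σ * u r) (σ * deriv (deriv u) r) hgt).1 (by
      simpa only [hσσ] using hode r hr.1 hr.2)
    rw [← hσσ (deriv (deriv u) r)]
    congr 1
    field_simp
    linarith
  have h0S : (0 : ℝ) ∈ S := ⟨le_rfl, by simpa using hR⟩
  have hSconv : Convex ℝ S := by
    refine Set.OrdConnected.convex ⟨fun x hx y hy z hz => ⟨hx.1.trans hz.1, ?_⟩⟩
    exact (EReal.coe_le_coe_iff.2 hz.2).trans_lt hy.2
  have hlt : IsOpen {r : ℝ | (r : EReal) < R} := isOpen_Iio.preimage continuous_coe_real_ereal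
  have hSnhds : ∀ r ∈ S, 0 < r → S ∈ 𝓝 r := fun r hr h0 =>
    inter_mem (Ici_mem_nhds h0) (hlt.mem_nhds hr.2)
  have hu2 : ∀ r ∈ S, 0 < r → ContDiffAt ℝ 2 u r := fun r hr h0 =>
    (hu r hr).contDiffAt (hSnhds r hr h0)
  have hdu : ∀ r ∈ S, 0 < r → HasDerivAt u (deriv u r) r := fun r hr h0 =>
    ((hu2 r hr h0).differentiableAt (by norm_num)).hasDerivAt
  have hddu : ∀ r ∈ S, DifferentiableAt ℝ (deriv u) r := fun r hr => by
    rcases hr.1.eq_or_lt with rfl | h0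
    · refine differentiableAt_of_deriv_ne_zero ?_
      have hgt : α < σ * u 0 := by rwa [hu0]
      rw [hode' 0 h0S hgt]
      have hσ0 : σ ≠ 0 := by rintro rfl; simp at hσ
      exact mul_ne_zero hσ0 (div_ne_zero (neg_ne_zero.2 (hgneg _ hgt).ne) hμ.ne')
    · exact ((((hu.mono interior_subset).deriv_of_isOpen (m := 1) isOpen_interior
        (by norm_num [one_add_one_eq_two])).differentiableOn one_ne_zero).differentiableAt
        (isOpen_interior.mem_nhds (mem_interior_iff_mem_nhds.2 (hSnhds r hr h0))))
  obtain ⟨hgt, hm, hm₁⟩ := strictMonoOn_of_convex_while_gt (w := fun r => σ * u r)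
    (w₁ := fun r => σ * deriv u r) (α := α) hSconv h0S (fun r hr => hr.1)
    (continuousOn_const.mul hu.continuousOn)
    (continuousOn_const.mul fun r hr => (hddu r hr).continuousAt.continuousWithinAt)
    (by simpa only [hu0] using hξ) (by simp only [hu'0, mul_zero])
    (fun r hr h0 => (hdu r hr h0).const_mul σ) (fun r hr h0 hgt => by
      rw [((hddu r hr).hasDerivAt.const_mul σ).deriv, hode' r hr hgt, hσσ]
      exact div_pos (neg_pos.2 (hgneg _ hgt)) hμ)
  have habs : ∀ r ∈ S, |u r| = σ * u r := fun r hr => by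
    rw [← abs_of_pos (hα.trans (hgt r hr)), abs_mul]
    rcases mul_self_eq_one_iff.1 hσ with rfl | rfl <;> simp
  have hmono : StrictMonoOn (fun r => |u r|) S := hm.congr fun r hr => (habs r hr).symm
  have hunb : ∀ B, ∃ r ∈ S, B ≤ σ * u r := by
    by_contra! ⟨B, hB⟩
    induction R with
    | bot => simp at hR
    | top =>
      have hSI : S = Ici 0 := by ext; simp [hS]
      have hpos : 0 < σ * deriv u 1 := by
        have h := hm₁ h0S (hSI ▸ zero_le_one' ℝ : (1 : ℝ) ∈ S) one_pos
        simpa only [hu'0, mul_zero] using h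
      have hlin := (convex_Ici (1 : ℝ)).mul_sub_le_image_sub_of_le_deriv
        (f := fun r => σ * u r) (C := σ * deriv u 1)
        ((continuousOn_const.mul hu.continuousOn).mono (hSI ▸ Ici_subset_Ici.2 zero_le_one))
        (fun r hr => by
          have hr1 : 1 < r := by simpa using hr
          exact ((hdu r (hSI ▸ (by linarith : 0 ≤ r)) (by linarith)).const_mul
            σ).differentiableAt.differentiableWithinAt)
        (fun r hr => by
          have hr1 : 1 < r := by simpa using hr
          have hrS : r ∈ S := hSI ▸ (by linarith : 0 ≤ r)
          rw [((hdu r hrS (by linarith)).const_mul σ).deriv]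
          exact (hm₁ (hSI ▸ zero_le_one' ℝ : (1 : ℝ) ∈ S) hrS hr1).le)
        1 self_mem_Ici
      have hB1 := hgt 1 (hSI ▸ zero_le_one' ℝ : (1 : ℝ) ∈ S)
      have hBpos : 0 < B := hα.trans (hB1.trans (hB 1 (hSI ▸ zero_le_one' ℝ : (1 : ℝ) ∈ S)))
      have hr1 : 1 ≤ 1 + B / (σ * deriv u 1) := by
        have : 0 < B / (σ * deriv u 1) := by positivity
        linarith
      have hl := hlin _ hr1 hr1
      have hu := hB (1 + B / (σ * deriv u 1)) (hSI ▸ zero_le_one.trans hr1)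
      rw [add_sub_cancel_left, mul_div_cancel₀ _ hpos.ne'] at hl
      linarith
    | coe b =>
      have hSI : S = Ico 0 b := by ext; simp [hS]
      have hb : 0 < b := by simpa using hR
      have hf : LocallyLipschitz fun t => -g t / μ := by
        have h : LipschitzWith ‖-μ⁻¹‖₊ fun t : ℝ => -μ⁻¹ * t := lipschitzWith_smul (-μ⁻¹)
        convert h.locallyLipschitz.comp hg using 2 with t
        simp [div_eq_inv_mul]
      obtain ⟨ε, hε, v, v₁, hvu, hvgt, hv⟩ := exists_extension_of_bounded hf hb
        (hSI ▸ hgt) (fun r hr => (hB r (hSI ▸ hr)).le)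
        (hSI ▸ continuousOn_const.mul fun r hr => (hddu r hr).continuousAt.continuousWithinAt)
        (hSI ▸ hm) (hSI ▸ hm₁)
        (fun r hr => (hdu r (hSI ▸ Ioo_subset_Ico_self hr) hr.1).const_mul σ)
        (fun r hr => by
          have hrS : r ∈ S := hSI ▸ Ioo_subset_Ico_self hr
          have h := (hddu r hrS).hasDerivAt.const_mul σ
          rwa [hode' r hrS (hgt r hrS), hσσ] at h)
      have heq : EqOn (fun r => σ * v r) u (Iio b) := fun r hr => by
        simp only [hvu hr, hσσ]
      have hev : ∀ r < b, (fun r => σ * v r) =ᶠ[𝓝 r] u := fun r hr =>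
        heq.eventuallyEq_of_mem (Iio_mem_nhds hr)
      have hd : ∀ r ∈ Ioo 0 (b + ε), HasDerivAt (fun r => σ * v r) (σ * v₁ r) r :=
        fun r hr => (hv r hr).1.const_mul σ
      have hd₁ : ∀ r ∈ Ioo 0 (b + ε),
          HasDerivAt (deriv fun r => σ * v r) (σ * (-g (v r) / μ)) r := fun r hr =>
        ((hv r hr).2.const_mul σ).congr_of_eventuallyEq <| by
          filter_upwards [Ioo_mem_nhds hr.1 hr.2] with s hs using (hd s hs).deriv
      have hC2 : ContDiffOn ℝ 2 (fun r => σ * v r) (Ioo 0 (b + ε)) := by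
        rw [show (2 : WithTop ℕ∞) = 1 + 1 from one_add_one_eq_two.symm,
          contDiffOn_succ_iff_deriv_of_isOpen isOpen_Ioo]
        refine ⟨fun r hr => (hd r hr).differentiableAt.differentiableWithinAt, by simp, ?_⟩
        rw [show (1 : WithTop ℕ∞) = 0 + 1 from (zero_add 1).symm,
          contDiffOn_succ_iff_deriv_of_isOpen isOpen_Ioo]
        refine ⟨fun r hr => (hd₁ r hr).differentiableAt.differentiableWithinAt, by simp, ?_⟩
        rw [contDiffOn_zero]
        have hc : ContinuousOn v (Ioo 0 (b + ε)) := fun r hr =>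
          (hv r hr).1.continuousAt.continuousWithinAt
        exact (continuousOn_const.mul (hf.continuous.comp_continuousOn hc)).congr
          fun r hr => (hd₁ r hr).deriv
      refine hmax ⟨((b + ε : ℝ) : EReal), fun r => σ * v r,
        by exact_mod_cast (by linarith : b < b + ε), ?_, ?_, (heq hb).trans hu0, (hev 0 hb).deriv_eq.trans hu'0,
        fun r _ hr => heq (EReal.coe_lt_coe_iff.1 hr)⟩
      · rintro r ⟨hr0, hr⟩
        have hr' : r < b + ε := EReal.coe_lt_coe_iff.1 hr
        rcases hr0.eq_or_lt with rfl | h0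
        · have hS0 : ContDiffWithinAt ℝ 2 u
              {r : ℝ | 0 ≤ r ∧ (r : EReal) < ((b + ε : ℝ) : EReal)} 0 :=
            (hu 0 h0S).mono_of_mem_nhdsWithin <| by
              filter_upwards [self_mem_nhdsWithin, mem_nhdsWithin_of_mem_nhds (hlt.mem_nhds h0S.2)]
                with s hs hs' using ⟨hs.1, hs'⟩
          exact hS0.congr_of_eventuallyEq ((hev 0 hb).filter_mono nhdsWithin_le_nhds) (heq hb)
        · exact (hC2.contDiffAt (Ioo_mem_nhds h0 hr')).contDiffWithinAt
      · intro r hr0 hr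
        have hr' : r < b + ε := EReal.coe_lt_coe_iff.1 hr
        rcases hr0.eq_or_lt with rfl | h0
        · rw [(hev 0 hb).deriv.deriv_eq]
          simpa only [heq hb] using hode 0 le_rfl h0S.2
        · rw [(hd₁ r ⟨h0, hr'⟩).deriv]
          refine (hM _ _ (hvgt r ⟨hr0, hr'⟩)).2 ?_
          field_simp
          ring
  refine ⟨hmono.mono fun r hr => ⟨hr.1.le, hr.2⟩, tendsto_atTop.2 fun B => ?_⟩
  obtain ⟨r, hr, hBr⟩ := hunb B
  filter_upwards [preimage_mem_comap (Ioo_mem_nhdsLT hr.2)] with s hs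
  have hrs : r < s := EReal.coe_lt_coe_iff.1 hs.1
  have hsS : s ∈ S := ⟨hr.1.trans hrs.le, hs.2⟩
  rw [habs s hsS]
  exact hBr.trans (hm hr hsS hrs).le

/-- one-dimensional Pucci maximal operator, |ξ| > α:
`|u|` is strictly increasing on `(0,R)` and `|u(r)| → +∞` as `r → R⁻`. -/
theorem pucci_1d_plus_large_data
    (lam Lam : ℝ) (hlam : 0 < lam) (hlamLam : lam ≤ Lam)
    (g : ℝ → ℝ) (hg1 : LocallyLipschitz g)
    (hg2 : ∀ t, g (-t) = - g t)
    (α : ℝ) (hα : 0 < α)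
    (hg3pos : ∀ t, 0 < t → t < α → 0 < g t)
    (hg3neg : ∀ t, α < t → g t < 0)
    (ξ : ℝ) (hξ : α < |ξ|)
    (R : EReal) (hR : 0 < R)
    (u : ℝ → ℝ)
    (hu : ContDiffOn ℝ 2 u {r : ℝ | 0 ≤ r ∧ (r : EReal) < R})
    (hode : ∀ r : ℝ, 0 ≤ r → (r : EReal) < R →
      (if 0 ≤ deriv (deriv u) r then Lam * deriv (deriv u) r
        else lam * deriv (deriv u) r) + g (u r) = 0)
    (hu0 : u 0 = ξ) (hu'0 : deriv u 0 = 0)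
    (hmax : ¬ ∃ (R' : EReal) (v : ℝ → ℝ), R < R' ∧
      ContDiffOn ℝ 2 v {r : ℝ | 0 ≤ r ∧ (r : EReal) < R'} ∧
      (∀ r : ℝ, 0 ≤ r → (r : EReal) < R' →
        (if 0 ≤ deriv (deriv v) r then Lam * deriv (deriv v) r
          else lam * deriv (deriv v) r) + g (v r) = 0) ∧
      v 0 = ξ ∧ deriv v 0 = 0 ∧
      (∀ r : ℝ, 0 ≤ r → (r : EReal) < R → v r = u r)) :
    StrictMonoOn (fun r => |u r|) {r : ℝ | 0 < r ∧ (r : EReal) < R} ∧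
    Tendsto (fun r => |u r|)
      (comap (fun r : ℝ => (r : EReal)) (𝓝[<] R)) atTop := by
  have hLam : 0 < Lam := hlam.trans_le hlamLam
  rcases lt_abs.1 hξ with h | h
  · refine strictMonoOn_abs_and_tendsto_of_maximal (σ := 1) (μ := Lam)
      (M := fun d => if 0 ≤ d then Lam * d else lam * d) hg1 hα hg3neg (one_mul 1) hLam
      (fun t d ht => ?_) (by rwa [one_mul]) hR hu hode hu0 hu'0 hmax
    have hneg := hg3neg t ht
    simp only [one_mul]
    split_ifs with hd
    · rfl
    · push Not at hd
      constructor <;> intro <;> nlinarith [mul_neg_of_pos_of_neg hlam hd,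
        mul_neg_of_pos_of_neg hLam hd]
  · refine strictMonoOn_abs_and_tendsto_of_maximal (σ := -1) (μ := lam)
      (M := fun d => if 0 ≤ d then Lam * d else lam * d) hg1 hα hg3neg (by norm_num) hlam
      (fun t d ht => ?_) (by rwa [neg_one_mul]) hR hu hode hu0 hu'0 hmax
    have hneg := hg3neg t ht
    simp only [neg_one_mul, hg2]
    split_ifs with hd
    · have h₁ : Lam * d ≤ 0 := mul_nonpos_of_nonneg_of_nonpos hLam.le (by linarith)
      have h₂ : lam * d ≤ 0 := mul_nonpos_of_nonneg_of_nonpos hlam.le (by linarith)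
      constructor <;> intro <;> linarith
    · constructor <;> intro <;> linarith
end

section
/- Let ξ ∈ ℝ with 0 < ξ < α and Λ G(ξ) < λ G(α), and let u ∈ C²([0,R)) be the solution of the Cauchy problem M⁺(u'') + g(u) = 0, u(0) = ξ, u'(0) = 0 on its maximal interval of existence [0,R). Then R = +∞, u is oscillating (it has an unbounded sequence of zeros), u is periodic (there exists T > 0 with u(r+T) = u(r) for all r ≥ 0), and sup_{r ≥ 0} |u(r)| = −u(r₂) < α, where r₂ is the first critical point of u in (0,+∞), which is a local minimizer of u. -/
open Set Filter Topology

/-- The phase-plane field `(x, y) ↦ (y, -f x)` inherits the Lipschitz property of `f`. -/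
theorem lipschitzWith_secondOrderField {f : ℝ → ℝ} {K : NNReal} (hf : LipschitzWith K f) :
    LipschitzWith (max 1 K) (fun p : ℝ × ℝ => (p.2, -f p.1)) := by
  have h1 : LipschitzWith K (fun p : ℝ × ℝ => -f p.1) := by
    have h := (hf.comp (LipschitzWith.prod_fst (α := ℝ) (β := ℝ))).neg
    rwa [mul_one] at h
  exact LipschitzWith.prod_snd.prodMk h1

theorem secondOrder_unique {f : ℝ → ℝ} {K : NNReal} (hf : LipschitzWith K f)
    {x₁ y₁ x₂ y₂ : ℝ → ℝ} {t₀ : ℝ}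
    (hx₁ : ∀ t, HasDerivAt x₁ (y₁ t) t) (hy₁ : ∀ t, HasDerivAt y₁ (-f (x₁ t)) t)
    (hx₂ : ∀ t, HasDerivAt x₂ (y₂ t) t) (hy₂ : ∀ t, HasDerivAt y₂ (-f (x₂ t)) t)
    (hx : x₁ t₀ = x₂ t₀) (hy : y₁ t₀ = y₂ t₀) (t : ℝ) : x₁ t = x₂ t := by
  have h := ODE_solution_unique_univ (v := fun _ p => (p.2, -f p.1)) (s := fun _ => univ)
    (f := fun t => (x₁ t, y₁ t)) (g := fun t => (x₂ t, y₂ t)) (t₀ := t₀)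
    (fun _ => (lipschitzWith_secondOrderField hf).lipschitzOnWith)
    (fun t => ⟨(hx₁ t).prodMk (hy₁ t), trivial⟩) (fun t => ⟨(hx₂ t).prodMk (hy₂ t), trivial⟩)
    (by simp [hx, hy])
  exact congrArg Prod.fst (congrFun h t)

/-- Rescaling the position by `T` makes the Picard-Lindelöf time bound hold on `[-T, T]`. -/
theorem secondOrder_exists_Ioo {f : ℝ → ℝ} {K B : NNReal} (hf : LipschitzWith K f)
    (hB : ∀ x, |f x| ≤ B) (ξ : ℝ) {T : ℝ} (hT : 0 < T) :
    ∃ γ : ℝ → ℝ × ℝ, γ 0 = (ξ, 0) ∧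
      ∀ t ∈ Ioo (-T) T, HasDerivAt γ ((γ t).2, -f (γ t).1) t := by
  lift T to NNReal using hT.le
  have hlin : LipschitzWith T (fun z : ℝ => (T : ℝ) * z) :=
    LipschitzWith.of_dist_le_mul fun a b => by
      simp [Real.dist_eq, ← mul_sub, abs_mul]
  have hlin' : LipschitzWith T⁻¹ (fun z : ℝ => (T : ℝ)⁻¹ * z) :=
    LipschitzWith.of_dist_le_mul fun a b => by
      simp [Real.dist_eq, ← mul_sub, abs_mul]
  have hV := (hlin'.comp LipschitzWith.prod_snd).prodMk
    (((hf.comp hlin).comp LipschitzWith.prod_fst).neg : LipschitzWith _ fun p : ℝ × ℝ => _)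
  have hPL := IsPicardLindelof.of_time_independent (tmin := -(T : ℝ)) (tmax := T)
    (t₀ := ⟨0, by simp⟩) (x₀ := (((T : ℝ)⁻¹ * ξ, 0) : ℝ × ℝ)) (a := B * T) (r := 0) (L := B)
    (f := fun p : ℝ × ℝ => ((T : ℝ)⁻¹ * p.2, -f (T * p.1))) ?_ hV.lipschitzOnWith ?_
  · obtain ⟨γ, h0, hγ⟩ := hPL.exists_eq_forall_mem_Icc_hasDerivWithinAt₀
    refine ⟨fun t => (T * (γ t).1, (γ t).2), ?_, fun t ht => ?_⟩
    · simp only at h0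
      simp [h0, hT.ne']
    · have h := (hγ t (Ioo_subset_Icc_self ht)).hasDerivAt (Icc_mem_nhds ht.1 ht.2)
      have h1 : HasDerivAt (fun t => (γ t).1) ((T : ℝ)⁻¹ * (γ t).2) t :=
        (hasFDerivAt_fst (𝕜 := ℝ) (p := γ t)).comp_hasDerivAt t h
      have h2 : HasDerivAt (fun t => (γ t).2) (-f (T * (γ t).1)) t :=
        (hasFDerivAt_snd (𝕜 := ℝ) (p := γ t)).comp_hasDerivAt t h
      have h3 := (h1.const_mul (T : ℝ)).prodMk h2
      rwa [mul_inv_cancel_left₀ hT.ne'] at h3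
  · rintro p hp
    rw [Metric.mem_closedBall, dist_eq_norm] at hp
    have hp2 := (norm_snd_le _).trans hp
    simp only [Prod.snd_sub, sub_zero, NNReal.coe_mul, Real.norm_eq_abs] at hp2
    refine norm_prod_le_iff.2 ⟨?_, by simpa using hB _⟩
    simp only [norm_mul, norm_inv, Real.norm_eq_abs, NNReal.abs_eq]
    rw [inv_mul_le_iff₀ hT]
    linarith
  · simp

theorem secondOrder_exists {f : ℝ → ℝ} {K B : NNReal} (hf : LipschitzWith K f)
    (hB : ∀ x, |f x| ≤ B) (ξ : ℝ) :
    ∃ x y : ℝ → ℝ, x 0 = ξ ∧ y 0 = 0 ∧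
      (∀ t, HasDerivAt x (y t) t) ∧ ∀ t, HasDerivAt y (-f (x t)) t := by
  choose γ h0 hγ using fun n : ℕ =>
    secondOrder_exists_Ioo hf hB ξ (T := (n : ℝ) + 1) (by positivity)
  have hmono : ∀ m n : ℕ, m ≤ n → EqOn (γ m) (γ n) (Ioo (-((m : ℝ) + 1)) (m + 1)) := by
    intro m n hmn
    have hmn' : (m : ℝ) ≤ n := by exact_mod_cast hmn
    refine ODE_solution_unique_of_mem_Ioo (v := fun _ p => (p.2, -f p.1)) (s := fun _ => univ)
      (t₀ := 0) (fun _ _ => (lipschitzWith_secondOrderField hf).lipschitzOnWith)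
      ⟨by linarith [m.cast_nonneg (α := ℝ)], by positivity⟩
      (fun t ht => ⟨hγ m t ht, trivial⟩)
      (fun t ht => ⟨hγ n t ⟨by linarith [ht.1], by linarith [ht.2]⟩, trivial⟩) (by rw [h0, h0])
  have heq : ∀ (n : ℕ) (t : ℝ), |t| < n + 1 → γ ⌈|t|⌉₊ t = γ n t := by
    intro n t ht
    have h1 : |t| < (⌈|t|⌉₊ : ℝ) + 1 := (Nat.le_ceil _).trans_lt (lt_add_one _)
    rcases le_total ⌈|t|⌉₊ n with h | h
    · exact hmono _ _ h (abs_lt.1 h1)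
    · exact (hmono _ _ h (abs_lt.1 ht)).symm
  have key : ∀ t, HasDerivAt (fun s => γ ⌈|s|⌉₊ s) ((γ ⌈|t|⌉₊ t).2, -f (γ ⌈|t|⌉₊ t).1) t := by
    intro t
    have h1 : |t| < (⌈|t|⌉₊ : ℝ) + 1 := (Nat.le_ceil _).trans_lt (lt_add_one _)
    refine (hγ _ t (abs_lt.1 h1)).congr_of_eventuallyEq ?_
    filter_upwards [continuous_abs.continuousAt.eventually_lt_const h1] with s hs
    exact heq _ s hs
  refine ⟨fun t => (γ ⌈|t|⌉₊ t).1, fun t => (γ ⌈|t|⌉₊ t).2, by simp [h0], by simp [h0],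
    fun t => HasFDerivAt.comp_hasDerivAt (f := fun s => γ ⌈|s|⌉₊ s) t hasFDerivAt_fst (key t),
    fun t => HasFDerivAt.comp_hasDerivAt (f := fun s => γ ⌈|s|⌉₊ s) t hasFDerivAt_snd (key t)⟩

theorem exists_first_zero {h : ℝ → ℝ} (hc : Continuous h) {a b : ℝ} (hab : a ≤ b)
    (ha : 0 < h a) (hb : h b ≤ 0) : ∃ c, a < c ∧ h c = 0 ∧ ∀ t ∈ Ico a c, 0 < h t := by
  have hK : IsCompact (Icc a b ∩ {t | h t ≤ 0}) :=
    isCompact_Icc.inter_right (isClosed_le hc continuous_const)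
  obtain ⟨c, ⟨hcI, hc0⟩, hcl⟩ := hK.exists_isLeast ⟨b, ⟨hab, le_rfl⟩, hb⟩
  obtain ⟨s, hs, hs0⟩ := intermediate_value_Icc' hcI.1 hc.continuousOn ⟨hc0, ha.le⟩
  have hsc : s = c := le_antisymm hs.2 (hcl ⟨⟨hs.1, hs.2.trans hcI.2⟩, hs0.le⟩)
  subst hsc
  refine ⟨s, lt_of_le_of_ne hcI.1 fun h => by subst h; linarith, hs0, fun t ht => ?_⟩
  by_contra! hneg
  exact absurd (hcl ⟨⟨ht.1, ht.2.le.trans hcI.2⟩, hneg⟩) (not_le.2 ht.2)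

/-- For the equation of motion under a restoring force `-f`, the solution released at rest from
`a > 0` descends to `-m`, where `-m` is at the same potential level as `a`, and is periodic. -/
theorem secondOrder_periodic {f : ℝ → ℝ} {K B : NNReal} (hf : LipschitzWith K f)
    (hB : ∀ x, |f x| ≤ B) (hpos : ∀ x, 0 < x → 0 < f x) (hneg : ∀ x, x < 0 → f x < 0)
    {a m : ℝ} (ha : 0 < a) (hm : 0 < m)
    (hE : ∫ s in (0 : ℝ)..a, f s = ∫ s in (0 : ℝ)..(-m), f s) :
    ∃ (x y : ℝ → ℝ) (r : ℝ), 0 < r ∧ x 0 = a ∧ y 0 = 0 ∧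
      (∀ t, HasDerivAt x (y t) t) ∧ (∀ t, HasDerivAt y (-f (x t)) t) ∧
      y r = 0 ∧ x r = -m ∧ (∀ t ∈ Ioo 0 r, y t < 0) ∧ (∀ t, x t ∈ Icc (-m) a) ∧
      ∀ t, x (t + 2 * r) = x t := by
  obtain ⟨x, y, hx0, hy0, hx, hy⟩ := secondOrder_exists hf hB a
  have hxc : Continuous x := continuous_iff_continuousAt.2 fun t => (hx t).continuousAt
  have hyc : Continuous y := continuous_iff_continuousAt.2 fun t => (hy t).continuousAt
  set Φ : ℝ → ℝ := fun z => ∫ s in (0 : ℝ)..z, f s with hΦ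
  have hΦd : ∀ z, HasDerivAt Φ (f z) z :=
    fun z => (hf.continuous.integral_hasStrictDerivAt 0 z).hasDerivAt
  have hΦc : Continuous Φ := continuous_iff_continuousAt.2 fun t => (hΦd t).continuousAt
  have hmono : StrictMonoOn Φ (Ici 0) :=
    strictMonoOn_of_deriv_pos (convex_Ici 0) hΦc.continuousOn fun z hz => by
      rw [interior_Ici] at hz
      rw [(hΦd z).deriv]
      exact hpos z hz
  have hanti : StrictAntiOn Φ (Iic 0) :=
    strictAntiOn_of_deriv_neg (convex_Iic 0) hΦc.continuousOn fun z hz => by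
      rw [interior_Iic] at hz
      rw [(hΦd z).deriv]
      exact hneg z hz
  have hEd : ∀ t, HasDerivAt (fun t => y t ^ 2 / 2 + Φ (x t)) 0 t := fun t => by
    have h := (((hy t).pow 2).div_const 2).add ((hΦd (x t)).comp t (hx t))
    exact h.congr_deriv (by push_cast; ring)
  have henergy : ∀ t, y t ^ 2 / 2 + Φ (x t) = Φ a := fun t => by
    have h := is_const_of_deriv_eq_zero (fun t => (hEd t).differentiableAt)
      (fun t => (hEd t).deriv) t 0
    simpa [hx0, hy0] using h
  have hmem : ∀ t, x t ∈ Icc (-m) a := by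
    intro t
    have h1 : Φ (x t) ≤ Φ a := by nlinarith [henergy t, sq_nonneg (y t)]
    constructor
    · by_contra! h
      have := hanti (show x t ∈ Iic 0 from mem_Iic.2 (by linarith))
        (show -m ∈ Iic 0 from mem_Iic.2 (by linarith)) h
      have h2 : Φ a = Φ (-m) := hE
      linarith
    · by_contra! h
      have := hmono (mem_Ici.2 ha.le) (mem_Ici.2 (ha.trans h).le) h
      linarith
  have hex1 : ∃ t, 0 ≤ t ∧ x t ≤ 0 := by
    by_contra! hxp
    have hya : StrictAntiOn y (Ici 0) :=
      strictAntiOn_of_deriv_neg (convex_Ici 0) hyc.continuousOn fun t ht => by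
        rw [interior_Ici] at ht
        rw [(hy t).deriv]
        linarith [hpos _ (hxp t (le_of_lt ht))]
    have hy1 : y 1 < 0 := hy0 ▸ hya (mem_Ici.2 le_rfl) (mem_Ici.2 zero_le_one) zero_lt_one
    have hlin := (convex_Ici (1 : ℝ)).image_sub_le_mul_sub_of_deriv_le (f := x) (C := y 1)
      hxc.continuousOn (fun t _ => (hx t).differentiableAt.differentiableWithinAt)
      (fun t ht => by
        rw [interior_Ici, mem_Ioi] at ht
        rw [(hx t).deriv]
        exact (hya (mem_Ici.2 zero_le_one) (mem_Ici.2 (by linarith)) ht).le)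
    have h := hlin 1 (mem_Ici.2 le_rfl) (1 + a / -y 1)
      (mem_Ici.2 (by have := div_pos ha (neg_pos.2 hy1); linarith))
      (by have := div_pos ha (neg_pos.2 hy1); linarith)
    have h2 : y 1 * (1 + a / -y 1 - 1) = -a := by
      field_simp [hy1.ne]
      ring
    have h3 := hxp (1 + a / -y 1) (by have := div_pos ha (neg_pos.2 hy1); linarith)
    linarith [(hmem 1).2]
  obtain ⟨b, hb0, hb⟩ := hex1
  obtain ⟨z, hz0, hxz, hxpos⟩ := exists_first_zero hxc hb0 (hx0 ▸ ha) hb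
  have hya : StrictAntiOn y (Icc 0 z) :=
    strictAntiOn_of_deriv_neg (convex_Icc 0 z) hyc.continuousOn fun t ht => by
      rw [interior_Icc] at ht
      rw [(hy t).deriv]
      linarith [hpos _ (hxpos t ⟨ht.1.le, ht.2⟩)]
  have hyneg : ∀ t ∈ Ioc 0 z, y t < 0 := fun t ht =>
    hy0 ▸ hya ⟨le_rfl, hz0.le⟩ ⟨ht.1.le, ht.2⟩ ht.1
  have hex2 : ∃ t, z ≤ t ∧ 0 ≤ y t := by
    by_contra! hyn
    have hxa : StrictAntiOn x (Ici z) :=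
      strictAntiOn_of_deriv_neg (convex_Ici z) hxc.continuousOn fun t ht => by
        rw [interior_Ici] at ht
        rw [(hx t).deriv]
        exact hyn t (le_of_lt ht)
    have hx1 : x (z + 1) < 0 := hxz ▸ hxa (mem_Ici.2 le_rfl) (mem_Ici.2 (by linarith)) (by linarith)
    obtain ⟨w, hw, hwmax⟩ := isCompact_Icc.exists_isMaxOn
      ⟨x (z + 1), (hmem _).1, le_rfl⟩ hf.continuous.continuousOn
    have hfw : f w < 0 := hneg w (hw.2.trans_lt hx1)
    have hlin := (convex_Ici (z + 1)).mul_sub_le_image_sub_of_le_deriv (f := y) (C := -f w)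
      hyc.continuousOn (fun t _ => (hy t).differentiableAt.differentiableWithinAt)
      (fun t ht => by
        rw [interior_Ici, mem_Ioi] at ht
        rw [(hy t).deriv]
        have : f (x t) ≤ f w := hwmax ⟨(hmem t).1,
          (hxa (mem_Ici.2 (by linarith)) (mem_Ici.2 (by linarith)) ht).le⟩
        linarith)
    have hy1 := hyn (z + 1) (by linarith)
    have hq : 0 < -y (z + 1) / -f w := div_pos (by linarith) (by linarith)
    have h := hlin (z + 1) (mem_Ici.2 le_rfl) (z + 1 + -y (z + 1) / -f w)
      (mem_Ici.2 (by linarith)) (by linarith)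
    have h2 : -f w * (z + 1 + -y (z + 1) / -f w - (z + 1)) = -y (z + 1) := by
      field_simp [hfw.ne]
      ring
    linarith [hyn (z + 1 + -y (z + 1) / -f w) (by linarith)]
  obtain ⟨b', hb'z, hb'⟩ := hex2
  obtain ⟨r, hzr, hyr, hynr⟩ := exists_first_zero hyc.neg hb'z
    (by simpa using hyneg z ⟨hz0, le_rfl⟩) (by simpa using hb')
  simp only [Pi.neg_apply, neg_eq_zero, neg_pos] at hyr hynr
  have hr : 0 < r := hz0.trans hzr
  have hyn : ∀ t ∈ Ioo 0 r, y t < 0 := fun t ht => by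
    rcases le_or_gt t z with h | h
    · exact hyneg t ⟨ht.1, h⟩
    · exact hynr t ⟨h.le, ht.2⟩
  have hxa : StrictAntiOn x (Icc 0 r) :=
    strictAntiOn_of_deriv_neg (convex_Icc 0 r) hxc.continuousOn fun t ht => by
      rw [interior_Icc] at ht
      rw [(hx t).deriv]
      exact hyn t ht
  have hxr0 : x r < 0 := hxz ▸ hxa ⟨hz0.le, hzr.le⟩ ⟨hr.le, le_rfl⟩ hzr
  have hxr : x r = -m := by
    refine hanti.injOn (mem_Iic.2 hxr0.le) (mem_Iic.2 (by linarith)) ?_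
    have h := henergy r
    rw [hyr] at h
    have h2 : Φ a = Φ (-m) := hE
    linarith
  have hreflect : ∀ c, y c = 0 → ∀ t, x (2 * c - t) = x t := fun c hc =>
    secondOrder_unique hf (x₁ := fun t => x (2 * c - t)) (y₁ := fun t => -y (2 * c - t)) (t₀ := c)
      (fun t => by simpa using (hx (2 * c - t)).comp_const_sub (2 * c) t)
      (fun t => by simpa using ((hy (2 * c - t)).comp_const_sub (2 * c) t).fun_neg) hx hy
      (by ring_nf) (by ring_nf; simp [hc])
  refine ⟨x, y, r, hr, hx0, hy0, hx, hy, hyr, hxr, hyn, hmem, fun t => ?_⟩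
  rw [← hreflect r hyr, ← hreflect 0 hy0]
  ring_nf

/-- The value `F` for which the Pucci equation `M⁺(a) + c = 0` reads `a = -F`. -/
noncomputable def pucciForce (lam Lam c : ℝ) : ℝ := lam⁻¹ * max c 0 - Lam⁻¹ * max (-c) 0

theorem pucciForce_of_nonneg {lam Lam c : ℝ} (hc : 0 ≤ c) :
    pucciForce lam Lam c = lam⁻¹ * c := by
  simp [pucciForce, hc]

theorem pucciForce_of_nonpos {lam Lam c : ℝ} (hc : c ≤ 0) :
    pucciForce lam Lam c = Lam⁻¹ * c := by
  simp [pucciForce, hc]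

theorem pucci_add_eq_zero_iff {lam Lam : ℝ} (hlam : 0 < lam) (hLam : 0 < Lam) (a c : ℝ) :
    (if 0 ≤ a then Lam * a else lam * a) + c = 0 ↔ a = -pucciForce lam Lam c := by
  rcases le_or_gt c 0 with hc | hc
  · rw [pucciForce_of_nonpos hc, ← mul_neg, eq_inv_mul_iff_mul_eq₀ hLam.ne']
    split_ifs with ha
    · constructor <;> intro h <;> linarith
    · have h1 : lam * a < 0 := mul_neg_of_pos_of_neg hlam (not_le.1 ha)
      have h2 : Lam * a < 0 := mul_neg_of_pos_of_neg hLam (not_le.1 ha)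
      constructor <;> intro h <;> linarith
  · rw [pucciForce_of_nonneg hc.le, ← mul_neg, eq_inv_mul_iff_mul_eq₀ hlam.ne']
    split_ifs with ha
    · have h1 : 0 ≤ lam * a := mul_nonneg hlam.le ha
      have h2 : 0 ≤ Lam * a := mul_nonneg hLam.le ha
      constructor <;> intro h <;> linarith
    · constructor <;> intro h <;> linarith

theorem locallyLipschitz_pucciForce_comp {g : ℝ → ℝ} (hg : LocallyLipschitz g) (lam Lam : ℝ) :
    LocallyLipschitz (fun t => pucciForce lam Lam (g t)) := by
  have h1 : LocallyLipschitz (fun t => lam⁻¹ * max (g t) 0) :=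
    (lipschitzWith_smul lam⁻¹).locallyLipschitz.comp (hg.max_const 0)
  have h2 : LocallyLipschitz (fun t => Lam⁻¹ * max (-g t) 0) :=
    (lipschitzWith_smul Lam⁻¹).locallyLipschitz.comp (LocallyLipschitz.max_const hg.neg 0)
  exact h1.sub h2

theorem LocallyLipschitz.exists_lipschitzWith_comp_projIcc {f : ℝ → ℝ} (hf : LocallyLipschitz f)
    {c d : ℝ} (hcd : c ≤ d) :
    ∃ K B : NNReal, LipschitzWith K (fun x => f (projIcc c d hcd x)) ∧
      ∀ x, |f (projIcc c d hcd x)| ≤ B := by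
  obtain ⟨K, hK⟩ := hf.locallyLipschitzOn.exists_lipschitzOnWith_of_compact
    (isCompact_Icc (a := c) (b := d))
  obtain ⟨B, hB⟩ := isCompact_Icc.exists_bound_of_continuousOn
    (hf.continuous.continuousOn (s := Icc c d))
  refine ⟨K * 1, B.toNNReal, hK.to_restrict.comp (LipschitzWith.projIcc hcd), fun x => ?_⟩
  exact (hB _ (projIcc c d hcd x).2).trans (Real.le_coe_toNNReal B)

theorem secondOrder_eqOn_Icc {f : ℝ → ℝ} (hf : LocallyLipschitz f) {x₁ y₁ x₂ y₂ : ℝ → ℝ} {b : ℝ}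
    (hx₁c : ContinuousOn x₁ (Icc 0 b)) (hy₁c : ContinuousOn y₁ (Icc 0 b))
    (hx₁ : ∀ t ∈ Ico 0 b, HasDerivWithinAt x₁ (y₁ t) (Ici t) t)
    (hy₁ : ∀ t ∈ Ico 0 b, HasDerivWithinAt y₁ (-f (x₁ t)) (Ici t) t)
    (hx₂c : ContinuousOn x₂ (Icc 0 b)) (hy₂c : ContinuousOn y₂ (Icc 0 b))
    (hx₂ : ∀ t ∈ Ico 0 b, HasDerivWithinAt x₂ (y₂ t) (Ici t) t)
    (hy₂ : ∀ t ∈ Ico 0 b, HasDerivWithinAt y₂ (-f (x₂ t)) (Ici t) t)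
    (hx : x₁ 0 = x₂ 0) (hy : y₁ 0 = y₂ 0) : EqOn x₁ x₂ (Icc 0 b) := by
  obtain ⟨M₁, hM₁⟩ := isCompact_Icc.exists_bound_of_continuousOn hx₁c
  obtain ⟨M₂, hM₂⟩ := isCompact_Icc.exists_bound_of_continuousOn hx₂c
  set M := max |M₁| |M₂|
  have hM : -M ≤ M := by linarith [(abs_nonneg M₁).trans (le_max_left |M₁| |M₂|)]
  obtain ⟨K, -, hK, -⟩ := hf.exists_lipschitzWith_comp_projIcc hM
  have hproj : ∀ z : ℝ, |z| ≤ M → f (projIcc (-M) M hM z) = f z := fun z hz => by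
    rw [projIcc_of_mem hM (abs_le.1 hz)]
  have h := ODE_solution_unique (v := fun _ p => (p.2, -f (projIcc (-M) M hM p.1)))
    (f := fun t => (x₁ t, y₁ t)) (g := fun t => (x₂ t, y₂ t)) (a := 0) (b := b)
    (fun _ => lipschitzWith_secondOrderField hK) (hx₁c.prodMk hy₁c)
    (fun t ht => by
      rw [hproj _ ((hM₁ t (Ico_subset_Icc_self ht)).trans
        ((le_abs_self _).trans (le_max_left _ _)))]
      exact (hx₁ t ht).prodMk (hy₁ t ht))
    (hx₂c.prodMk hy₂c)
    (fun t ht => by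
      rw [hproj _ ((hM₂ t (Ico_subset_Icc_self ht)).trans
        ((le_abs_self _).trans (le_max_right _ _)))]
      exact (hx₂ t ht).prodMk (hy₂ t ht))
    (by simp [hx, hy])
  exact fun t ht => congrArg Prod.fst (h ht)

theorem mem_nhds_of_pos_of_lt_ereal {R : EReal} {r : ℝ} (hr : 0 < r) (hrR : (r : EReal) < R) :
    {r : ℝ | 0 ≤ r ∧ (r : EReal) < R} ∈ 𝓝 r := by
  filter_upwards [lt_mem_nhds hr, continuous_coe_real_ereal.continuousAt.eventually_lt_const hrR]
    with s hs hsR using ⟨hs.le, hsR⟩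

theorem ContDiffOn.hasDerivAt_deriv_of_pos {R : EReal} {u : ℝ → ℝ}
    (hu : ContDiffOn ℝ 2 u {r : ℝ | 0 ≤ r ∧ (r : EReal) < R}) {r : ℝ} (hr : 0 < r)
    (hrR : (r : EReal) < R) :
    HasDerivAt u (deriv u r) r ∧ HasDerivAt (deriv u) (deriv (deriv u) r) r := by
  have h := hu.contDiffAt (mem_nhds_of_pos_of_lt_ereal hr hrR)
  have h1 : ContDiffAt ℝ 1 (deriv u) r := h.derivWithin (by norm_num)
  exact ⟨(h.differentiableAt (by norm_num)).hasDerivAt,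
    (h1.differentiableAt (by norm_num)).hasDerivAt⟩

/-- Away from the origin this is classical; at the origin the differentiability of `deriv u`
identifies the one-sided derivative of `u` with `deriv u 0`. -/
theorem ContDiffOn.hasDerivWithinAt_Ici_zero {R : EReal} (hR : 0 < R) {u : ℝ → ℝ}
    (hu : ContDiffOn ℝ 2 u {r : ℝ | 0 ≤ r ∧ (r : EReal) < R})
    (h0 : DifferentiableAt ℝ (deriv u) 0) : HasDerivWithinAt u (deriv u 0) (Ici 0) 0 := by
  obtain ⟨b, hb0, hbR⟩ := EReal.lt_iff_exists_real_btwn.1 hR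
  have hb : 0 < b := by exact_mod_cast hb0
  have hlt : ∀ r : ℝ, r ≤ b → (r : EReal) < R := fun r hr =>
    (EReal.coe_le_coe_iff.2 hr).trans_lt hbR
  refine hasDerivWithinAt_Ici_of_tendsto_deriv (s := Ioo 0 b)
    (fun r hr => ((hu.hasDerivAt_deriv_of_pos hr.1
      (hlt r hr.2.le)).1.differentiableAt).differentiableWithinAt)
    ((hu.continuousOn 0 ⟨le_rfl, by exact_mod_cast hR⟩).mono fun r hr =>
      ⟨hr.1.le, hlt r hr.2.le⟩)
    (Ioo_mem_nhdsGT hb) (h0.continuousAt.tendsto.mono_left nhdsWithin_le_nhds)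

theorem pucci_1d_plus_oscillating_case
    (lam Lam : ℝ) (hlam : 0 < lam) (hlamLam : lam ≤ Lam)
    (g : ℝ → ℝ) (hg1 : LocallyLipschitz g)
    (hg2 : ∀ t, g (-t) = - g t)
    (α : ℝ) (hα : 0 < α)
    (hg3pos : ∀ t, 0 < t → t < α → 0 < g t)
    (hg3neg : ∀ t, α < t → g t < 0)
    (G : ℝ → ℝ) (hG : ∀ t, G t = ∫ s in (0:ℝ)..t, g s)
    (ξ : ℝ) (hξ0 : 0 < ξ) (hξα : ξ < α)
    (hGlt : Lam * G ξ < lam * G α)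
    (R : EReal) (hR : 0 < R)
    (u : ℝ → ℝ)
    (hu : ContDiffOn ℝ 2 u {r : ℝ | 0 ≤ r ∧ (r : EReal) < R})
    (hode : ∀ r : ℝ, 0 ≤ r → (r : EReal) < R →
      (if 0 ≤ deriv (deriv u) r then Lam * deriv (deriv u) r
        else lam * deriv (deriv u) r) + g (u r) = 0)
    (hu0 : u 0 = ξ) (hu'0 : deriv u 0 = 0)
    (hmax : ¬ ∃ (R' : EReal) (v : ℝ → ℝ), R < R' ∧
      ContDiffOn ℝ 2 v {r : ℝ | 0 ≤ r ∧ (r : EReal) < R'} ∧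
      (∀ r : ℝ, 0 ≤ r → (r : EReal) < R' →
        (if 0 ≤ deriv (deriv v) r then Lam * deriv (deriv v) r
        else lam * deriv (deriv v) r) + g (v r) = 0) ∧
      v 0 = ξ ∧ deriv v 0 = 0 ∧
      (∀ r : ℝ, 0 ≤ r → (r : EReal) < R → v r = u r))
 :
    R = ⊤ ∧
    (∀ M : ℝ, ∃ r, M ≤ r ∧ u r = 0) ∧
    (∃ T > 0, ∀ r, 0 ≤ r → u (r + T) = u r) ∧
    (∃ r₂ > 0, deriv u r₂ = 0 ∧
      (∀ r, 0 < r → r < r₂ → deriv u r ≠ 0) ∧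
      IsLocalMin u r₂ ∧
      sSup ((fun r => |u r|) '' Set.Ici 0) = - u r₂ ∧ - u r₂ < α) := by
  have hLam : 0 < Lam := hlam.trans_le hlamLam
  have hgc := hg1.continuous
  have hg0 : g 0 = 0 := by
    have := hg2 0
    rw [neg_zero] at this
    linarith
  have hgint : ∀ a b, IntervalIntegrable g MeasureTheory.volume a b := hgc.intervalIntegrable
  have hGsub : ∀ a b, G b - G a = ∫ s in a..b, g s := fun a b => by
    rw [hG, hG]
    exact intervalIntegral.integral_interval_sub_left (hgint _ _) (hgint _ _)
  have hGmono : ∀ a b, 0 ≤ a → a < b → b ≤ α → G a < G b := fun a b ha hab hb => by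
    rw [← sub_pos, hGsub]
    exact intervalIntegral.intervalIntegral_pos_of_pos_on (hgint _ _)
      (fun s hs => hg3pos s (ha.trans_lt hs.1) (hs.2.trans_le hb)) hab
  have hG0 : G 0 = 0 := by simp [hG]
  have hGξ : 0 < G ξ := hG0 ▸ hGmono 0 ξ le_rfl hξ0 hξα.le
  have hGc : Continuous G := by
    rw [funext hG]
    exact intervalIntegral.continuous_primitive hgint 0
  have hGneg : ∀ t, G (-t) = G t := fun t => by
    have h := intervalIntegral.integral_comp_neg (a := 0) (b := t) g
    simp only [hg2, intervalIntegral.integral_neg, neg_zero] at h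
    rw [hG, hG, intervalIntegral.integral_symm, ← h, neg_neg]
  obtain ⟨m, hm, hGm⟩ := intermediate_value_Ioo hα.le hGc.continuousOn
    (show Lam / lam * G ξ ∈ Ioo (G 0) (G α) from
      ⟨by rw [hG0]; positivity, by rwa [div_mul_eq_mul_div, div_lt_iff₀' hlam]⟩)
  have hξm : ξ ≤ m := by
    by_contra! h
    have h1 := hGmono m ξ hm.1.le h hξα.le
    have h2 : 1 * G ξ ≤ Lam / lam * G ξ :=
      mul_le_mul_of_nonneg_right ((one_le_div hlam).2 hlamLam) hGξ.le
    linarith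
  set F : ℝ → ℝ := fun t => pucciForce lam Lam (g t) with hF
  have hFl : LocallyLipschitz F := locallyLipschitz_pucciForce_comp hg1 lam Lam
  have hFpos : ∀ t, 0 < t → t ≤ ξ → 0 < F t := fun t ht htξ => by
    have := hg3pos t ht (htξ.trans_lt hξα)
    rw [hF]
    simp only [pucciForce_of_nonneg this.le]
    positivity
  have hgneg : ∀ t, t < 0 → -m ≤ t → g t < 0 := fun t ht htm => by
    have h1 := hg3pos (-t) (by linarith) (by linarith [hm.2])
    rw [hg2] at h1
    linarith
  have hFneg : ∀ t, t < 0 → -m ≤ t → F t < 0 := fun t ht htm => by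
    have h1 := hgneg t ht htm
    rw [hF]
    simp only [pucciForce_of_nonpos h1.le]
    exact mul_neg_of_pos_of_neg (inv_pos.2 hLam) h1
  have hmξ : -m ≤ ξ := by linarith [hm.1]
  obtain ⟨K, B, hK, hB⟩ := hFl.exists_lipschitzWith_comp_projIcc hmξ
  have hproj : ∀ z ∈ Icc (-m) ξ, F (projIcc (-m) ξ hmξ z) = F z := fun z hz => by
    rw [projIcc_of_mem hmξ hz]
  have hI1 : ∫ s in (0 : ℝ)..ξ, F (projIcc (-m) ξ hmξ s) = lam⁻¹ * G ξ := by
    rw [hG, ← intervalIntegral.integral_const_mul]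
    refine intervalIntegral.integral_congr fun s hs => ?_
    rw [uIcc_of_le hξ0.le] at hs
    simp only [hproj s ⟨by linarith [hm.1, hs.1], hs.2⟩]
    refine pucciForce_of_nonneg ?_
    rcases hs.1.eq_or_lt with h | h
    · rw [← h, hg0]
    · exact (hg3pos s h (hs.2.trans_lt hξα)).le
  have hI2 : ∫ s in (0 : ℝ)..(-m), F (projIcc (-m) ξ hmξ s) = Lam⁻¹ * G (-m) := by
    rw [hG, ← intervalIntegral.integral_const_mul]
    refine intervalIntegral.integral_congr fun s hs => ?_
    rw [uIcc_of_ge (by linarith [hm.1])] at hs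
    simp only [hproj s ⟨hs.1, by linarith [hs.2]⟩]
    refine pucciForce_of_nonpos ?_
    rcases hs.2.eq_or_lt with h | h
    · rw [h, hg0]
    · exact (hgneg s h hs.1).le
  obtain ⟨x, y, r, hr, hx0, hy0, hx, hy', hyr, hxr, hyn, hmem, hper⟩ :=
    secondOrder_periodic hK hB
      (fun z hz => hFpos _ (by rw [coe_projIcc]; simp [hz, hξ0]) (projIcc (-m) ξ hmξ z).2.2)
      (fun z hz => hFneg _ (by rw [coe_projIcc]; simp [hz, hm.1]) (projIcc (-m) ξ hmξ z).2.1)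
      hξ0 hm.1 (by rw [hI1, hI2, hGneg, hGm]; field_simp)
  have hy : ∀ t, HasDerivAt y (-F (x t)) t := fun t => hproj _ (hmem t) ▸ hy' t
  have hxc : Continuous x := continuous_iff_continuousAt.2 fun t => (hx t).continuousAt
  have hyc : Continuous y := continuous_iff_continuousAt.2 fun t => (hy t).continuousAt
  have hdx : deriv x = y := funext fun t => (hx t).deriv
  have hdy : deriv y = fun t => -F (x t) := funext fun t => (hy t).deriv
  have hode' : ∀ t : ℝ, 0 ≤ t → (t : EReal) < R → deriv (deriv u) t = -F (u t) :=
    fun t ht htR => (pucci_add_eq_zero_iff hlam hLam _ _).1 (hode t ht htR)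
  have hdu0 : DifferentiableAt ℝ (deriv u) 0 := by
    refine differentiableAt_of_deriv_ne_zero ?_
    rw [hode' 0 le_rfl (by exact_mod_cast hR), hu0]
    exact (neg_neg_of_pos (hFpos ξ hξ0 le_rfl)).ne
  have huder : ∀ t : ℝ, 0 ≤ t → (t : EReal) < R →
      HasDerivWithinAt u (deriv u t) (Ici t) t ∧ HasDerivAt (deriv u) (-F (u t)) t := by
    intro t ht htR
    rw [← hode' t ht htR]
    rcases ht.eq_or_lt with rfl | ht
    · exact ⟨hu.hasDerivWithinAt_Ici_zero hR hdu0, hdu0.hasDerivAt⟩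
    · have h := hu.hasDerivAt_deriv_of_pos ht htR
      exact ⟨h.1.hasDerivWithinAt, h.2⟩
  have hux : ∀ b : ℝ, 0 ≤ b → (b : EReal) < R → u b = x b := by
    intro b hb hbR
    have hlt : ∀ t ∈ Icc 0 b, (t : EReal) < R := fun t ht =>
      (EReal.coe_le_coe_iff.2 ht.2).trans_lt hbR
    have hsub : ∀ t ∈ Ico 0 b, t ∈ Icc 0 b := fun t ht => Ico_subset_Icc_self ht
    exact secondOrder_eqOn_Icc hFl (y₁ := deriv u) (y₂ := y)
      (hu.continuousOn.mono fun t ht => ⟨ht.1, hlt t ht⟩)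
      (fun t ht => (huder t ht.1 (hlt t ht)).2.continuousAt.continuousWithinAt)
      (fun t ht => (huder t ht.1 (hlt t (hsub t ht))).1)
      (fun t ht => (huder t ht.1 (hlt t (hsub t ht))).2.hasDerivWithinAt)
      hxc.continuousOn hyc.continuousOn (fun t _ => (hx t).hasDerivWithinAt)
      (fun t _ => (hy t).hasDerivWithinAt) (hu0.trans hx0.symm) (hu'0.trans hy0.symm) ⟨hb, le_rfl⟩
  have hRtop : R = ⊤ := by
    by_contra hne
    refine hmax ⟨⊤, x, lt_top_iff_ne_top.2 hne, ContDiff.contDiffOn ?_, fun t _ _ => ?_, hx0,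
      by rw [hdx, hy0], fun t ht htR => (hux t ht htR).symm⟩
    · have hy1 : ContDiff ℝ 1 y := contDiff_one_iff_deriv.2
        ⟨fun t => (hy t).differentiableAt, by rw [hdy]; exact (hFl.continuous.comp hxc).neg⟩
      exact (contDiff_succ_iff_deriv (n := 1)).2
        ⟨fun t => (hx t).differentiableAt, by simp, by rwa [hdx]⟩
    · rw [pucci_add_eq_zero_iff hlam hLam, hdx, hdy]
  subst hRtop
  have hux' : ∀ t : ℝ, 0 ≤ t → u t = x t := fun t ht => hux t ht (EReal.coe_lt_top t)
  have hdu : ∀ t : ℝ, 0 < t → deriv u t = y t := fun t ht => by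
    rw [← hdx]
    refine Filter.EventuallyEq.deriv_eq ?_
    filter_upwards [lt_mem_nhds ht] with s hs using hux' s hs.le
  have hur : u r = -m := (hux' r hr.le).trans hxr
  refine ⟨rfl, fun M => ?_, ⟨2 * r, by positivity, fun t ht => ?_⟩, r, hr, ?_, fun t ht htr => ?_,
    ?_, ?_, ?_⟩
  · obtain ⟨z, hz, hxz⟩ := intermediate_value_Icc' hr.le hxc.continuousOn
      (show (0 : ℝ) ∈ Icc (x r) (x 0) by rw [hxr, hx0]; exact ⟨by linarith [hm.1], hξ0.le⟩)
    obtain ⟨k, hk⟩ := exists_nat_ge (M / (2 * r))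
    rw [div_le_iff₀ (by positivity)] at hk
    have hperk : x (z + k * (2 * r)) = x z := (Function.Periodic.nat_mul hper k) z
    refine ⟨z + k * (2 * r), by linarith [hz.1], ?_⟩
    rw [hux' _ (by have := hz.1; positivity), hperk, hxz]
  · rw [hux' t ht, hux' _ (by positivity), hper]
  · rw [hdu r hr, hyr]
  · rw [hdu t ht]
    exact (hyn t ⟨ht, htr⟩).ne
  · filter_upwards [lt_mem_nhds hr] with t ht
    rw [hur, hux' t ht.le]
    exact (hmem t).1
  · rw [hur, neg_neg]
    refine IsGreatest.csSup_eq ⟨⟨r, hr.le, by simp [hur, abs_of_pos hm.1]⟩, ?_⟩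
    rintro _ ⟨t, ht, rfl⟩
    simp only [hux' t ht]
    exact abs_le.2 ⟨(hmem t).1, (hmem t).2.trans hξm⟩
  · rw [hur, neg_neg]
    exact hm.2
end

section
/- Let ξ ∈ ℝ with −α < ξ < 0 and Λ G(ξ) = λ G(α), and let u ∈ C²([0,R)) be the solution of the Cauchy problem M⁻(u'') + g(u) = 0, u(0) = ξ, u'(0) = 0 on its maximal interval of existence [0,R). Then R = +∞, −α < u(r) < α for all r ≥ 0, u is strictly increasing on (0,+∞), and u(r) → α as r → +∞. -/
open Set Filter Topology

/-- Two solutions of an autonomous ODE with locally Lipschitz vector field that agree at one point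
of an open interval agree on the whole interval. -/
theorem LocallyLipschitz.eqOn_Ioo_of_hasDerivAt {E : Type*} [NormedAddCommGroup E]
    [NormedSpace ℝ E] {X : E → E} (hX : LocallyLipschitz X) {y z : ℝ → E} {a b t₀ : ℝ}
    (ht₀ : t₀ ∈ Ioo a b) (hy : ∀ t ∈ Ioo a b, HasDerivAt y (X (y t)) t)
    (hz : ∀ t ∈ Ioo a b, HasDerivAt z (X (z t)) t) (h : y t₀ = z t₀) :
    EqOn y z (Ioo a b) := by
  intro t ht
  obtain ⟨c, hac, hc⟩ := exists_between (lt_min ht₀.1 ht.1)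
  obtain ⟨d, hd, hdb⟩ := exists_between (max_lt ht₀.2 ht.2)
  rw [lt_min_iff] at hc
  rw [max_lt_iff] at hd
  have hsub : Icc c d ⊆ Ioo a b := Icc_subset_Ioo hac hdb
  have hyc : ContinuousOn y (Icc c d) := fun s hs ↦
    (hy s (hsub hs)).continuousAt.continuousWithinAt
  have hzc : ContinuousOn z (Icc c d) := fun s hs ↦
    (hz s (hsub hs)).continuousAt.continuousWithinAt
  obtain ⟨K, hK⟩ := LocallyLipschitzOn.exists_lipschitzOnWith_of_compact
    ((isCompact_Icc.image_of_continuousOn hyc).union (isCompact_Icc.image_of_continuousOn hzc))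
    hX.locallyLipschitzOn
  have hmem : Ioo c d ⊆ Icc c d := Ioo_subset_Icc_self
  exact ODE_solution_unique_of_mem_Ioo (v := fun _ ↦ X) (fun _ _ ↦ hK) ⟨hc.1, hd.1⟩
    (fun s hs ↦ ⟨hy s (hsub (hmem hs)), Or.inl (mem_image_of_mem y (hmem hs))⟩)
    (fun s hs ↦ ⟨hz s (hsub (hmem hs)), Or.inr (mem_image_of_mem z (hmem hs))⟩) h ⟨hc.2, hd.2⟩

/-- A bounded solution of an autonomous ODE with locally Lipschitz vector field can be continued
past the right end of its interval of definition. -/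
theorem LocallyLipschitz.exists_extension_of_bounded {E : Type*} [NormedAddCommGroup E]
    [NormedSpace ℝ E] [ProperSpace E] {X : E → E} (hX : LocallyLipschitz X) {y : ℝ → E}
    {a b M : ℝ} (hab : a < b) (hy : ∀ t ∈ Ioo a b, HasDerivAt y (X (y t)) t)
    (hM : ∀ t ∈ Ioo a b, ‖y t‖ ≤ M) :
    ∃ ε > 0, a ≤ b - ε ∧ ∃ z : ℝ → E,
      (∀ t ∈ Ioo (b - ε) (b + ε), HasDerivAt z (X (z t)) t) ∧ EqOn y z (Ioo (b - ε) b) := by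
  have hcomp : IsCompact (Metric.closedBall (0 : E) (M + 1)) := isCompact_closedBall _ _
  obtain ⟨K, hK⟩ := LocallyLipschitzOn.exists_lipschitzOnWith_of_compact hcomp
    (hX.locallyLipschitzOn)
  obtain ⟨C, hC⟩ := hcomp.exists_bound_of_continuousOn hX.continuous.continuousOn
  set L : NNReal := Real.toNNReal C with hL
  obtain ⟨ε, hε, hεab, hεL⟩ : ∃ ε > 0, 2 * ε ≤ b - a ∧ (L : ℝ) * (2 * ε) ≤ 1 := by
    refine ⟨min ((b - a) / 2) (1 / (2 * (L + 1))), ?_, ?_, ?_⟩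
    · have := sub_pos.2 hab
      positivity
    · linarith [min_le_left ((b - a) / 2) (1 / (2 * ((L : ℝ) + 1)))]
    · have h1 := min_le_right ((b - a) / 2) (1 / (2 * ((L : ℝ) + 1)))
      have h0 : (0 : ℝ) ≤ L := L.2
      calc (L : ℝ) * (2 * min ((b - a) / 2) (1 / (2 * (L + 1))))
          ≤ L * (2 * (1 / (2 * (L + 1)))) := by gcongr
        _ ≤ 1 := by
          rw [show (L : ℝ) * (2 * (1 / (2 * (L + 1)))) = L / (L + 1) by field_simp]
          rw [div_le_one (by positivity)]
          linarith
  have ht₀ : b - ε / 2 ∈ Ioo a b := ⟨by linarith, by linarith⟩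
  have hball : Metric.closedBall (y (b - ε / 2)) (1 : NNReal) ⊆ Metric.closedBall 0 (M + 1) := by
    refine Metric.closedBall_subset_closedBall' ?_
    rw [dist_zero_right, NNReal.coe_one]
    linarith [hM _ ht₀]
  have hpl : IsPicardLindelof (fun _ ↦ X) (tmin := b - ε) (tmax := b + ε)
      ⟨b - ε / 2, by constructor <;> linarith⟩ (y (b - ε / 2)) 1 0 L K := by
    refine ⟨fun _ _ ↦ hK.mono hball, fun _ _ ↦ continuousOn_const, fun _ _ x hx ↦ ?_, ?_⟩
    · exact (hC x (hball hx)).trans (Real.le_coe_toNNReal C)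
    · have : max (b + ε - (b - ε / 2)) (b - ε / 2 - (b - ε)) ≤ 2 * ε :=
        max_le (by linarith) (by linarith)
      simpa using (mul_le_mul_of_nonneg_left this L.2).trans hεL
  obtain ⟨z, hz₀, hz⟩ := hpl.exists_eq_forall_mem_Icc_hasDerivWithinAt₀
  have hz' : ∀ t ∈ Ioo (b - ε) (b + ε), HasDerivAt z (X (z t)) t := fun t ht ↦
    (hz t (Ioo_subset_Icc_self ht)).hasDerivAt (Icc_mem_nhds ht.1 ht.2)
  exact ⟨ε, hε, by linarith, z, hz', hX.eqOn_Ioo_of_hasDerivAt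
    (t₀ := b - ε / 2) ⟨by linarith, by linarith⟩
    (fun t ht ↦ hy t ⟨by linarith [ht.1], ht.2⟩)
    (fun t ht ↦ hz' t ⟨ht.1, by linarith [ht.2]⟩) hz₀.symm⟩

theorem contDiffOn_two_Ioo_of_hasDerivAt {f w q : ℝ → ℝ} {a b : ℝ} (hf : Continuous f)
    (hw : ∀ t ∈ Ioo a b, HasDerivAt w (q t) t)
    (hq : ∀ t ∈ Ioo a b, HasDerivAt q (f (w t)) t) : ContDiffOn ℝ 2 w (Ioo a b) := by
  have hwd : EqOn (deriv w) q (Ioo a b) := fun t ht ↦ (hw t ht).deriv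
  have hqd : EqOn (deriv q) (f ∘ w) (Ioo a b) := fun t ht ↦ (hq t ht).deriv
  have hq1 : ContDiffOn ℝ 1 q (Ioo a b) := by
    rw [show (1 : WithTop ℕ∞) = 0 + 1 by simp, contDiffOn_succ_iff_deriv_of_isOpen isOpen_Ioo]
    refine ⟨fun t ht ↦ (hq t ht).differentiableAt.differentiableWithinAt, by simp, ?_⟩
    rw [contDiffOn_zero]
    refine ContinuousOn.congr ?_ hqd
    exact hf.comp_continuousOn fun t ht ↦ (hw t ht).continuousAt.continuousWithinAt
  rw [show (2 : WithTop ℕ∞) = 1 + 1 by norm_num, contDiffOn_succ_iff_deriv_of_isOpen isOpen_Ioo]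
  exact ⟨fun t ht ↦ (hw t ht).differentiableAt.differentiableWithinAt, by simp, hq1.congr hwd⟩

/-- Conservation of energy for `u'' = f(u)`. -/
theorem energy_eq_of_hasDerivAt {f F u p : ℝ → ℝ} {r : ℝ} (hr : 0 < r)
    (hF : ∀ t, HasDerivAt F (f t) t) (huc : ContinuousOn u (Icc 0 r))
    (hpc : ContinuousOn p (Icc 0 r)) (hu : ∀ t ∈ Ioo 0 r, HasDerivAt u (p t) t)
    (hp : ∀ t ∈ Ioo 0 r, HasDerivAt p (f (u t)) t) :
    p r ^ 2 / 2 - F (u r) = p 0 ^ 2 / 2 - F (u 0) := by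
  have hFc : Continuous F := continuous_iff_continuousAt.2 fun t ↦ (hF t).continuousAt
  obtain ⟨c, hc, h⟩ := exists_hasDerivAt_eq_slope (fun t ↦ p t ^ 2 / 2 - F (u t)) (fun _ ↦ 0) hr
    (((hpc.pow 2).div_const 2).sub (hFc.comp_continuousOn huc)) fun t ht ↦ by
      convert! (((hp t ht).pow 2).div_const 2).sub ((hF (u t)).comp t (hu t ht)) using 1
      ring
  rw [eq_comm, div_eq_zero_iff] at h
  rcases h with h | h <;> linarith

/-- A solution of `u'' = f(u)` issuing at rest from `ξ` increases strictly and stays below the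
equilibrium `α` lying at the same energy level. -/
theorem deriv_pos_and_lt_of_energy {f F u p : ℝ → ℝ} {ξ α : ℝ} {R : EReal}
    (hf : LocallyLipschitz f) (hF : ∀ t, HasDerivAt F (f t) t) (hξα : ξ < α)
    (hFξ : F ξ = F α) (hFpos : ∀ t ∈ Ioo ξ α, F α < F t) (hfξ : 0 < f ξ) (hfα : f α = 0)
    (hu0 : u 0 = ξ) (hp0 : p 0 = 0) (huc : ContinuousWithinAt u (Ici 0) 0)
    (hpd : HasDerivAt p (f ξ) 0)
    (hu : ∀ r : ℝ, 0 < r → (r : EReal) < R → HasDerivAt u (p r) r)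
    (hp : ∀ r : ℝ, 0 < r → (r : EReal) < R → HasDerivAt p (f (u r)) r)
    {r : ℝ} (hr : 0 < r) (hrR : (r : EReal) < R) :
    0 < p r ∧ ξ < u r ∧ u r < α ∧ p r ^ 2 / 2 = F (u r) - F α := by
  have hlt : ∀ {s t : ℝ}, s ≤ t → (t : EReal) < R → (s : EReal) < R := fun h ht ↦
    (EReal.coe_le_coe_iff.2 h).trans_lt ht
  have hucont : ∀ t : ℝ, (t : EReal) < R → ContinuousOn u (Icc 0 t) := by
    intro t ht s hs
    rcases hs.1.eq_or_lt with rfl | h0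
    · exact huc.mono Icc_subset_Ici_self
    · exact (hu s h0 (hlt hs.2 ht)).continuousAt.continuousWithinAt
  have hpcont : ∀ t : ℝ, (t : EReal) < R → ContinuousOn p (Icc 0 t) := by
    intro t ht s hs
    rcases hs.1.eq_or_lt with rfl | h0
    · exact hpd.continuousAt.continuousWithinAt
    · exact (hp s h0 (hlt hs.2 ht)).continuousAt.continuousWithinAt
  have hE : ∀ t : ℝ, 0 < t → (t : EReal) < R → p t ^ 2 / 2 = F (u t) - F α := by
    intro t h0 ht
    have := energy_eq_of_hasDerivAt h0 hF (hucont t ht) (hpcont t ht)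
      (fun s hs ↦ hu s hs.1 (hlt hs.2.le ht)) (fun s hs ↦ hp s hs.1 (hlt hs.2.le ht))
    rw [hp0, hu0, hFξ] at this
    linarith
  obtain ⟨δ, hδ, hpδ⟩ : ∃ δ > 0, ∀ t ∈ Ioo 0 δ, 0 < p t := by
    have h1 : Tendsto (slope p 0) (𝓝[>] 0) (𝓝 (f ξ)) :=
      (hasDerivAt_iff_tendsto_slope.1 hpd).mono_left
        (nhdsWithin_mono _ fun x hx ↦ (ne_of_gt hx : x ≠ 0))
    obtain ⟨δ, hδ, h2⟩ := mem_nhdsGT_iff_exists_Ioo_subset.1 (h1.eventually_const_lt hfξ)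
    refine ⟨δ, hδ, fun t ht ↦ ?_⟩
    have h3 : 0 < slope p 0 t := h2 ht
    rw [slope_def_field, hp0, sub_zero, sub_zero] at h3
    exact (div_pos_iff_of_pos_right ht.1).1 h3
  have hne : ∀ t : ℝ, 0 < t → (t : EReal) < R → u t ≠ α := by
    intro t h0 ht hut
    obtain ⟨b, htb, hbR⟩ := EReal.lt_iff_exists_real_btwn.1 ht
    rw [EReal.coe_lt_coe_iff] at htb
    have hpt : p t = 0 := by
      have := hE t h0 ht
      rw [hut, sub_self] at this
      simpa using this
    have hX : LocallyLipschitz fun x : ℝ × ℝ ↦ (x.2, f x.1) :=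
      LipschitzWith.prod_snd.locallyLipschitz.prodMk
        (hf.comp LipschitzWith.prod_fst.locallyLipschitz)
    have heq := hX.eqOn_Ioo_of_hasDerivAt (y := fun s ↦ (u s, p s)) (z := fun _ ↦ (α, 0))
      (t₀ := t) (a := 0) (b := b) ⟨h0, htb⟩
      (fun s hs ↦ (hu s hs.1 (hlt hs.2.le hbR)).prodMk (hp s hs.1 (hlt hs.2.le hbR)))
      (fun s hs ↦ by simpa [hfα] using! hasDerivAt_const s ((α, 0) : ℝ × ℝ))
      (by simp [hut, hpt])
    have hm : 0 < min δ b := lt_min hδ (h0.trans htb)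
    have h1 := hpδ (min δ b / 2) ⟨by linarith, by linarith [min_le_left δ b]⟩
    have h2 := heq (x := min δ b / 2) ⟨by linarith, by linarith [min_le_right δ b]⟩
    simp only [Prod.mk.injEq] at h2
    exact h1.ne' h2.2
  have hua : ∀ t : ℝ, 0 < t → (t : EReal) < R → u t < α := by
    intro t h0 ht
    by_contra! h
    obtain ⟨s, hs, hsα⟩ := intermediate_value_Icc h0.le (hucont t ht) ⟨hu0.trans_le hξα.le, h⟩
    have hs0 : 0 < s := hs.1.lt_of_ne (by rintro rfl; exact hξα.ne (hu0.symm.trans hsα))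
    exact hne s hs0 (hlt hs.2 ht) hsα
  have hinc : ∀ s : ℝ, 0 < s → (s : EReal) < R → (∀ t ∈ Ioo 0 s, 0 < p t) → ξ < u s := by
    intro s h0 hs h
    have := strictMonoOn_of_deriv_pos (convex_Icc 0 s) (hucont s hs) fun t ht ↦ by
      rw [interior_Icc] at ht
      rw [(hu t ht.1 (hlt ht.2.le hs)).deriv]
      exact h t ht
    exact hu0 ▸ this (left_mem_Icc.2 h0.le) (right_mem_Icc.2 h0.le) h0
  have hpp : ∀ t : ℝ, 0 < t → (t : EReal) < R → 0 < p t := by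
    intro t h0 ht
    by_contra! hpt
    have hδt : δ ≤ t := by
      by_contra! h
      exact (hpδ t ⟨h0, h⟩).not_ge hpt
    have hcl : IsCompact (Icc δ t ∩ p ⁻¹' Iic 0) :=
      isCompact_Icc.of_isClosed_subset
        (((hpcont t ht).mono (Icc_subset_Icc_left hδ.le)).preimage_isClosed_of_isClosed
          isClosed_Icc isClosed_Iic) inter_subset_left
    obtain ⟨s, ⟨hs, hps⟩, hmin⟩ := hcl.exists_isLeast ⟨t, ⟨hδt, le_rfl⟩, hpt⟩
    have hs0 : 0 < s := hδ.trans_le hs.1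
    have hsR := hlt hs.2 ht
    have hbefore : ∀ x ∈ Ioo 0 s, 0 < p x := by
      intro x hx
      by_contra! h
      rcases lt_or_ge x δ with h1 | h1
      · exact (hpδ x ⟨hx.1, h1⟩).not_ge h
      · exact hx.2.not_ge (hmin ⟨⟨h1, hx.2.le.trans hs.2⟩, h⟩)
    have hps0 : 0 ≤ p s := by
      refine ge_of_tendsto (x := 𝓝[<] s)
        ((hp s hs0 hsR).continuousAt.tendsto.mono_left nhdsWithin_le_nhds) ?_
      filter_upwards [Ioo_mem_nhdsLT hs0] with x hx using (hbefore x hx).le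
    have hpsz : p s = 0 := le_antisymm hps hps0
    have h1 := hFpos (u s) ⟨hinc s hs0 hsR hbefore, hua s hs0 hsR⟩
    have h2 := hE s hs0 hsR
    rw [hpsz] at h2
    linarith
  exact ⟨hpp r hr hrR, hinc r hr hrR fun t ht ↦ hpp t ht.1 (hlt ht.2.le hrR), hua r hr hrR,
    hE r hr hrR⟩

/-- Convergence to the equilibrium of an increasing orbit on its energy level. -/
theorem tendsto_atTop_of_energy {F u p : ℝ → ℝ} {ξ α : ℝ} (hF : Continuous F)
    (hFpos : ∀ t ∈ Ioo ξ α, F α < F t) (hu : ∀ r > 0, HasDerivAt u (p r) r)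
    (hp : ∀ r > 0, 0 < p r) (hur : ∀ r > 0, u r ∈ Ioo ξ α)
    (hE : ∀ r > 0, p r ^ 2 / 2 = F (u r) - F α) (hmono : StrictMonoOn u (Ioi 0)) :
    Tendsto u atTop (𝓝 α) := by
  refine tendsto_order.2 ⟨fun L hL ↦ ?_, fun L hL ↦ ?_⟩
  · suffices ∃ r > 0, L < u r by
      obtain ⟨r, hr, hLr⟩ := this
      filter_upwards [eventually_ge_atTop r] with s hs
      exact hLr.trans_le (hmono.monotoneOn hr (hr.trans_le hs) hs)
    by_contra! hle
    have h1 : (u 1) ∈ Icc (u 1) L := ⟨le_rfl, hle 1 one_pos⟩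
    obtain ⟨m, hm, hmin⟩ := isCompact_Icc.exists_isMinOn ⟨_, h1⟩ hF.continuousOn
    have hc : 0 < F m - F α :=
      sub_pos.2 (hFpos m ⟨(hur 1 one_pos).1.trans_le hm.1, hm.2.trans_lt hL⟩)
    set k := Real.sqrt (2 * (F m - F α)) with hk
    have hkpos : 0 < k := Real.sqrt_pos.2 (by linarith)
    have hpk : ∀ r : ℝ, 1 ≤ r → k ≤ p r := by
      intro r hr
      have hr0 : 0 < r := one_pos.trans_le hr
      refine Real.sqrt_le_iff.2 ⟨(hp r hr0).le, ?_⟩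
      have h2 : F m ≤ F (u r) :=
        hmin ⟨hmono.monotoneOn (mem_Ioi.2 one_pos) hr0 hr, hle r hr0⟩
      linarith [hE r hr0]
    have hlen : 0 < (α - u 1) / k := div_pos (sub_pos.2 (hur 1 one_pos).2) hkpos
    obtain ⟨c, hcm, hcs⟩ := exists_hasDerivAt_eq_slope u p
      (show (1 : ℝ) < 1 + (α - u 1) / k by linarith)
      (fun t ht ↦ (hu t (one_pos.trans_le ht.1)).continuousAt.continuousWithinAt)
      (fun t ht ↦ hu t (one_pos.trans ht.1))
    have h3 := hpk c hcm.1.le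
    rw [hcs, add_sub_cancel_left, le_div_iff₀ hlen, mul_div_cancel₀ _ hkpos.ne'] at h3
    linarith [(hur (1 + (α - u 1) / k) (by linarith)).2]
  · filter_upwards [eventually_gt_atTop 0] with r hr using (hur r hr).2.trans hL

/-- The equation `M⁻(d) + y = 0` for the one-dimensional Pucci minimal operator, solved for `d`. -/
theorem pucci_minus_add_eq_zero_iff {lam Lam : ℝ} (hlam : 0 < lam) (hlamLam : lam ≤ Lam)
    (d y : ℝ) :
    (if 0 ≤ d then lam * d else Lam * d) + y = 0 ↔ d = max (-lam⁻¹ * y) (-Lam⁻¹ * y) := by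
  have hLam : 0 < Lam := hlam.trans_le hlamLam
  have hinv : Lam⁻¹ ≤ lam⁻¹ := inv_anti₀ hlam hlamLam
  have hL : 0 < Lam⁻¹ := inv_pos.2 hLam
  have hl : 0 < lam⁻¹ := inv_pos.2 hlam
  have key : ∀ c : ℝ, 0 < c → (c * d + y = 0 ↔ d = -c⁻¹ * y) := by
    intro c hc
    have : c * (-c⁻¹ * y) = -y := by field_simp
    constructor
    · intro h
      exact mul_left_cancel₀ hc.ne' (by linarith)
    · rintro rfl
      linarith
  rcases le_or_gt y 0 with hy | hy
  · rw [max_eq_left (by nlinarith)]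
    split_ifs with hd
    · exact key lam hlam
    · constructor
      · intro h
        nlinarith
      · rintro rfl
        exact absurd (by nlinarith) hd
  · rw [max_eq_right (by nlinarith)]
    split_ifs with hd
    · constructor
      · intro h
        nlinarith
      · rintro rfl
        exact absurd (mul_pos hL hy) (by linarith)
    · exact key Lam hLam

theorem LocallyLipschitz.max_const_mul {g : ℝ → ℝ} (hg : LocallyLipschitz g) (a b : ℝ) :
    LocallyLipschitz fun t ↦ max (a * g t) (b * g t) :=
  ((lipschitzWith_smul a).max (lipschitzWith_smul b)).locallyLipschitz.comp hg

/-- The orbit of a solution on `[0, R)` of `u'' = f(u)` that stays bounded together with its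
derivative extends beyond `R`. -/
theorem exists_contDiffOn_extension {f u : ℝ → ℝ} (hf : LocallyLipschitz f) {R a b P : ℝ}
    (hR : 0 < R) (hu : ContDiffOn ℝ 2 u (Ico 0 R))
    (hode : ∀ r ∈ Ico 0 R, deriv (deriv u) r = f (u r))
    (hud : ∀ r ∈ Ioo 0 R, HasDerivAt u (deriv u r) r)
    (hpd : ∀ r ∈ Ioo 0 R, HasDerivAt (deriv u) (f (u r)) r)
    (hub : ∀ r ∈ Ioo 0 R, u r ∈ Icc a b) (hpb : ∀ r ∈ Ioo 0 R, |deriv u r| ≤ P) :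
    ∃ R' > R, ∃ v : ℝ → ℝ, ContDiffOn ℝ 2 v (Ico 0 R') ∧
      (∀ r ∈ Ico 0 R', deriv (deriv v) r = f (v r)) ∧ EqOn v u (Iio R) := by
  have hX : LocallyLipschitz fun x : ℝ × ℝ ↦ (x.2, f x.1) :=
    LipschitzWith.prod_snd.locallyLipschitz.prodMk
      (hf.comp LipschitzWith.prod_fst.locallyLipschitz)
  obtain ⟨ε, hε, hεR, z, hz, heq⟩ := hX.exists_extension_of_bounded
    (y := fun r ↦ (u r, deriv u r)) (a := 0) (b := R) (M := max (max |a| |b|) P) hR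
    (fun r hr ↦ (hud r hr).prodMk (hpd r hr))
    (fun r hr ↦ max_le_max (abs_le_max_abs_abs (hub r hr).1 (hub r hr).2) (hpb r hr))
  have hw : ∀ t ∈ Ioo (R - ε) (R + ε), HasDerivAt (fun s ↦ (z s).1) (z t).2 t := fun t ht ↦
    (ContinuousLinearMap.fst ℝ ℝ ℝ).hasFDerivAt.comp_hasDerivAt t (hz t ht)
  have hq : ∀ t ∈ Ioo (R - ε) (R + ε), HasDerivAt (fun s ↦ (z s).2) (f (z t).1) t := fun t ht ↦
    (ContinuousLinearMap.snd ℝ ℝ ℝ).hasFDerivAt.comp_hasDerivAt t (hz t ht)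
  have hw2 := contDiffOn_two_Ioo_of_hasDerivAt hf.continuous hw hq
  set v : ℝ → ℝ := fun r ↦ if r < R then u r else (z r).1 with hv
  have hvu : EqOn v u (Iio R) := fun r hr ↦ if_pos hr
  have hvz : EqOn v (fun s ↦ (z s).1) (Ioo (R - ε) (R + ε)) := by
    intro r hr
    by_cases h : r < R
    · simpa [hv, h] using congrArg Prod.fst (heq ⟨hr.1, h⟩)
    · simp [hv, h]
  refine ⟨R + ε, by linarith, v, fun r hr ↦ ?_, fun r hr ↦ ?_, hvu⟩
  · rcases lt_or_ge r R with h | h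
    · have h1 : ContDiffWithinAt ℝ 2 u (Ico 0 (R + ε)) r :=
        (hu r ⟨hr.1, h⟩).mono_of_mem_nhdsWithin (by
          filter_upwards [self_mem_nhdsWithin, mem_nhdsWithin_of_mem_nhds (Iio_mem_nhds h)]
            with s hs hs' using ⟨hs.1, hs'⟩)
      exact h1.congr_of_eventuallyEq
        (mem_nhdsWithin_of_mem_nhds (hvu.eventuallyEq_of_mem (Iio_mem_nhds h))) (hvu h)
    · have hr' : r ∈ Ioo (R - ε) (R + ε) := ⟨by linarith, hr.2⟩
      have hn := isOpen_Ioo.mem_nhds hr'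
      exact ((hw2.contDiffAt hn).congr_of_eventuallyEq
        (hvz.eventuallyEq_of_mem hn)).contDiffWithinAt
  · rcases lt_or_ge r R with h | h
    · rw [(hvu.eventuallyEq_of_mem (Iio_mem_nhds h)).deriv.deriv_eq, hvu h, hode r ⟨hr.1, h⟩]
    · have hr' : r ∈ Ioo (R - ε) (R + ε) := ⟨by linarith, hr.2⟩
      have hd : EqOn (deriv fun s ↦ (z s).1) (fun s ↦ (z s).2) (Ioo (R - ε) (R + ε)) :=
        fun t ht ↦ (hw t ht).deriv
      have hn := isOpen_Ioo.mem_nhds hr'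
      rw [(hvz.eventuallyEq_of_mem hn).deriv.deriv_eq, (hd.eventuallyEq_of_mem hn).deriv_eq,
        (hq r hr').deriv, hvz hr']

theorem pucci_1d_minus_heteroclinic_case
    (lam Lam : ℝ) (hlam : 0 < lam) (hlamLam : lam ≤ Lam)
    (g : ℝ → ℝ) (hg1 : LocallyLipschitz g)
    (hg2 : ∀ t, g (-t) = - g t)
    (α : ℝ) (hα : 0 < α)
    (hg3pos : ∀ t, 0 < t → t < α → 0 < g t)
    (hg3neg : ∀ t, α < t → g t < 0)
    (G : ℝ → ℝ) (hG : ∀ t, G t = ∫ s in (0:ℝ)..t, g s)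
    (ξ : ℝ) (hξα : -α < ξ) (hξ0 : ξ < 0)
    (hGeq : Lam * G ξ = lam * G α)
    (R : EReal) (hR : 0 < R)
    (u : ℝ → ℝ)
    (hu : ContDiffOn ℝ 2 u {r : ℝ | 0 ≤ r ∧ (r : EReal) < R})
    (hode : ∀ r : ℝ, 0 ≤ r → (r : EReal) < R →
      (if 0 ≤ deriv (deriv u) r then lam * deriv (deriv u) r
        else Lam * deriv (deriv u) r) + g (u r) = 0)
    (hu0 : u 0 = ξ) (hu'0 : deriv u 0 = 0)
    (hmax : ¬ ∃ (R' : EReal) (v : ℝ → ℝ), R < R' ∧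
      ContDiffOn ℝ 2 v {r : ℝ | 0 ≤ r ∧ (r : EReal) < R'} ∧
      (∀ r : ℝ, 0 ≤ r → (r : EReal) < R' →
        (if 0 ≤ deriv (deriv v) r then lam * deriv (deriv v) r
        else Lam * deriv (deriv v) r) + g (v r) = 0) ∧
      v 0 = ξ ∧ deriv v 0 = 0 ∧
      (∀ r : ℝ, 0 ≤ r → (r : EReal) < R → v r = u r))
 :
    R = ⊤ ∧
    (∀ r, 0 ≤ r → -α < u r ∧ u r < α) ∧
    StrictMonoOn u (Set.Ioi 0) ∧
    Tendsto u atTop (𝓝 α) := by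
  have hLam : 0 < Lam := hlam.trans_le hlamLam
  have hli : 0 < lam⁻¹ := inv_pos.2 hlam
  have hLi : 0 < Lam⁻¹ := inv_pos.2 hLam
  have hinv : Lam⁻¹ ≤ lam⁻¹ := inv_anti₀ hlam hlamLam
  set f : ℝ → ℝ := fun t ↦ max (-lam⁻¹ * g t) (-Lam⁻¹ * g t) with hfdef
  have hf : LocallyLipschitz f := hg1.max_const_mul _ _
  have hgc : Continuous g := hg1.continuous
  have hg0 : g 0 = 0 := by
    have := hg2 0
    rw [neg_zero] at this
    linarith
  have hgα : g α = 0 := by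
    refine le_antisymm ?_ ?_
    · refine le_of_tendsto (x := 𝓝[>] α) (hgc.continuousAt.tendsto.mono_left nhdsWithin_le_nhds) ?_
      filter_upwards [self_mem_nhdsWithin] with t ht using (hg3neg t ht).le
    · refine ge_of_tendsto (x := 𝓝[<] α) (hgc.continuousAt.tendsto.mono_left nhdsWithin_le_nhds) ?_
      filter_upwards [Ioo_mem_nhdsLT hα] with t ht using (hg3pos t ht.1 ht.2).le
  have hgneg : ∀ t, -α < t → t < 0 → g t < 0 := by
    intro t h1 h2
    have := hg3pos (-t) (by linarith) (by linarith)
    rw [hg2] at this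
    linarith
  have hfle : ∀ t, g t ≤ 0 → f t = -lam⁻¹ * g t := fun t ht ↦ max_eq_left (by nlinarith)
  have hfge : ∀ t, 0 ≤ g t → f t = -Lam⁻¹ * g t := fun t ht ↦ max_eq_right (by nlinarith)
  set F : ℝ → ℝ := fun t ↦ ∫ s in (0 : ℝ)..t, f s with hFdef
  have hF : ∀ t, HasDerivAt F (f t) t := fun t ↦
    (hf.continuous.integral_hasStrictDerivAt 0 t).hasDerivAt
  have hFc : Continuous F := continuous_iff_continuousAt.2 fun t ↦ (hF t).continuousAt
  have hFξ : F ξ = -lam⁻¹ * G ξ := by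
    rw [hG, ← intervalIntegral.integral_const_mul]
    refine intervalIntegral.integral_congr fun t ht ↦ hfle t ?_
    rw [uIcc_of_ge hξ0.le] at ht
    rcases ht.2.eq_or_lt with rfl | h
    · exact hg0.le
    · exact (hgneg t (by linarith [ht.1]) h).le
  have hFα : F α = -Lam⁻¹ * G α := by
    rw [hG, ← intervalIntegral.integral_const_mul]
    refine intervalIntegral.integral_congr fun t ht ↦ hfge t ?_
    rw [uIcc_of_le hα.le] at ht
    rcases ht.1.eq_or_lt with rfl | h
    · exact hg0.ge
    · rcases ht.2.eq_or_lt with rfl | h'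
      · exact hgα.ge
      · exact (hg3pos t h h').le
  have hFeq : F ξ = F α := by
    rw [hFξ, hFα]
    field_simp
    linarith
  have hFpos : ∀ t ∈ Ioo ξ α, F α < F t := by
    intro t ht
    rcases le_or_gt t 0 with h | h
    · rw [← hFeq]
      refine strictMonoOn_of_deriv_pos (convex_Icc ξ 0) hFc.continuousOn (fun s hs ↦ ?_)
        ⟨le_rfl, hξ0.le⟩ ⟨ht.1.le, h⟩ ht.1
      rw [interior_Icc] at hs
      have := hgneg s (hξα.trans hs.1) hs.2
      rw [(hF s).deriv, hfle s this.le]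
      nlinarith
    · refine strictAntiOn_of_deriv_neg (convex_Icc 0 α) hFc.continuousOn (fun s hs ↦ ?_)
        ⟨h.le, ht.2.le⟩ ⟨hα.le, le_rfl⟩ ht.2
      rw [interior_Icc] at hs
      have := hg3pos s hs.1 hs.2
      rw [(hF s).deriv, hfge s this.le]
      nlinarith
  have hfξ : 0 < f ξ := by
    have := hgneg ξ hξα hξ0
    rw [hfle ξ this.le]
    nlinarith
  have hfα : f α = 0 := by simp [hfdef, hgα]
  have hode' : ∀ r : ℝ, 0 ≤ r → (r : EReal) < R → deriv (deriv u) r = f (u r) := fun r h0 hr ↦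
    (pucci_minus_add_eq_zero_iff hlam hlamLam _ _).1 (hode r h0 hr)
  have hR0 : ((0 : ℝ) : EReal) < R := by simpa using hR
  have hpd0 : HasDerivAt (deriv u) (f ξ) 0 := by
    have h := hode' 0 le_rfl hR0
    rw [hu0] at h
    rw [← h]
    exact (differentiableAt_of_deriv_ne_zero (by rw [h]; exact hfξ.ne')).hasDerivAt
  have hud : ∀ r : ℝ, 0 < r → (r : EReal) < R →
      HasDerivAt u (deriv u r) r ∧ HasDerivAt (deriv u) (f (u r)) r := by
    intro r h0 hr
    obtain ⟨b, hrb, hbR⟩ := EReal.lt_iff_exists_real_btwn.1 hr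
    rw [EReal.coe_lt_coe_iff] at hrb
    have h2 : ContDiffOn ℝ 2 u (Ioo 0 b) := hu.mono fun s hs ↦
      ⟨hs.1.le, (EReal.coe_lt_coe_iff.2 hs.2).trans hbR⟩
    rw [show (2 : WithTop ℕ∞) = 1 + 1 by norm_num,
      contDiffOn_succ_iff_deriv_of_isOpen isOpen_Ioo] at h2
    have hn : Ioo 0 b ∈ 𝓝 r := Ioo_mem_nhds h0 hrb
    refine ⟨((h2.1 r ⟨h0, hrb⟩).differentiableAt hn).hasDerivAt, ?_⟩
    rw [← hode' r h0.le hr]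
    exact ((h2.2.2.contDiffAt hn).differentiableAt (by norm_num)).hasDerivAt
  have huc : ContinuousWithinAt u (Ici 0) 0 := by
    obtain ⟨b, h0b, hbR⟩ := EReal.lt_iff_exists_real_btwn.1 hR0
    rw [EReal.coe_lt_coe_iff] at h0b
    refine (hu.continuousOn 0 ⟨le_rfl, hR0⟩).mono_of_mem_nhdsWithin ?_
    filter_upwards [Ico_mem_nhdsGE h0b] with s hs
    exact ⟨hs.1, (EReal.coe_lt_coe_iff.2 hs.2).trans hbR⟩
  have key := fun {r : ℝ} (h0 : 0 < r) (hr : (r : EReal) < R) ↦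
    deriv_pos_and_lt_of_energy hf hF (hξ0.trans hα) hFeq hFpos hfξ hfα hu0 hu'0 huc hpd0
      (fun r h0 hr ↦ (hud r h0 hr).1) (fun r h0 hr ↦ (hud r h0 hr).2) h0 hr
  have hRtop : R = ⊤ := by
    by_contra hne
    lift R to ℝ using ⟨hne, (EReal.bot_lt_zero.trans hR).ne'⟩ with ρ
    have hset : ∀ b : ℝ, {r : ℝ | 0 ≤ r ∧ (r : EReal) < b} = Ico 0 b := by
      intro b
      ext r
      simp
    rw [hset] at hu
    obtain ⟨c, hc, hmax'⟩ := isCompact_Icc.exists_isMaxOn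
      (nonempty_Icc.2 (hξ0.trans hα).le) hFc.continuousOn
    obtain ⟨R', hR', v, hv, hvode, hvu⟩ := exists_contDiffOn_extension (a := ξ) (b := α)
      (P := Real.sqrt (2 * (F c - F α))) hf (EReal.coe_lt_coe_iff.1 hR0) hu
      (fun r hr ↦ hode' r hr.1 (EReal.coe_lt_coe_iff.2 hr.2))
      (fun r hr ↦ (hud r hr.1 (EReal.coe_lt_coe_iff.2 hr.2)).1)
      (fun r hr ↦ (hud r hr.1 (EReal.coe_lt_coe_iff.2 hr.2)).2)
      (fun r hr ↦ by
        obtain ⟨-, h1, h2, -⟩ := key hr.1 (EReal.coe_lt_coe_iff.2 hr.2)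
        exact ⟨h1.le, h2.le⟩)
      (fun r hr ↦ by
        obtain ⟨-, h1, h2, h3⟩ := key hr.1 (EReal.coe_lt_coe_iff.2 hr.2)
        have h4 : F (u r) ≤ F c := hmax' ⟨h1.le, h2.le⟩
        exact Real.abs_le_sqrt (by linarith))
    have hρ0 : 0 < ρ := EReal.coe_lt_coe_iff.1 hR0
    refine hmax ⟨R', v, EReal.coe_lt_coe_iff.2 hR', (hset R').symm ▸ hv, fun r h0 hr ↦ ?_,
      (hvu hρ0).trans hu0, ?_, fun r _ hr ↦ hvu (EReal.coe_lt_coe_iff.1 hr)⟩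
    · exact (pucci_minus_add_eq_zero_iff hlam hlamLam _ _).2
        (hvode r ⟨h0, EReal.coe_lt_coe_iff.1 hr⟩)
    · rw [(hvu.eventuallyEq_of_mem (Iio_mem_nhds hρ0)).deriv_eq, hu'0]
  subst hRtop
  have key' := fun {r : ℝ} (h0 : 0 < r) ↦ key h0 (EReal.coe_lt_top r)
  have hmono : StrictMonoOn u (Ioi 0) := by
    refine strictMonoOn_of_deriv_pos (convex_Ioi 0)
      (fun r hr ↦ (hud r hr (EReal.coe_lt_top r)).1.continuousAt.continuousWithinAt)
      fun r hr ↦ ?_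
    rw [interior_Ioi] at hr
    exact (key' hr).1
  refine ⟨rfl, fun r hr ↦ ?_, hmono, ?_⟩
  · rcases hr.eq_or_lt with rfl | h0
    · rw [hu0]
      exact ⟨hξα, hξ0.trans hα⟩
    · exact ⟨hξα.trans (key' h0).2.1, (key' h0).2.2.1⟩
  · exact tendsto_atTop_of_energy hFc hFpos (fun r hr ↦ (hud r hr (EReal.coe_lt_top r)).1)
      (fun r hr ↦ (key' hr).1) (fun r hr ↦ ⟨(key' hr).2.1, (key' hr).2.2.1⟩)
      (fun r hr ↦ (key' hr).2.2.2) hmono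
end

section
/- Let N ≥ 2 and let u be a C² solution of the radial Pucci equation θ(r) u''(r) + ((N−1)/r) Θ(r) u'(r) + g(u(r)) = 0 on an interval I ⊂ (0,+∞). If u' > 0 on I, then both E_λ and E_Λ are decreasing on I. -/
open Set Filter Topology

/-- On an interval where `u` is `C²` and `u' > 0`, the energy `c / 2 * u' ^ 2 + G u` is strictly
decreasing as soon as `c * u'' + g u` is negative. -/
theorem strictAntiOn_energy_of_deriv_pos {c : ℝ} {g G u : ℝ → ℝ} {I : Set ℝ}
    (hG : ∀ t, HasDerivAt G (g t) t) (hI : I.OrdConnected) (hu : ContDiffOn ℝ 2 u I)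
    (hu' : ∀ r ∈ I, 0 < deriv u r) (hneg : ∀ r ∈ I, c * deriv (deriv u) r + g (u r) < 0) :
    StrictAntiOn (fun r => c / 2 * (deriv u r) ^ 2 + G (u r)) I := by
  rcases I.subsingleton_or_nontrivial with hs | hnt
  · exact fun x hx y hy hxy => absurd (hs hx hy) hxy.ne
  have hconv : Convex ℝ I := hI.convex
  have hunique : UniqueDiffOn ℝ I := by
    obtain ⟨x, hx, y, hy, hxy⟩ := hnt.exists_lt
    refine uniqueDiffOn_convex hconv ⟨(x + y) / 2, ?_⟩
    refine interior_mono (hI.out hx hy) ?_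
    rw [interior_Icc]
    constructor <;> linarith
  -- A nonzero derivative is a genuine one, also at the endpoints of `I`.
  have hdiff : ∀ r ∈ I, DifferentiableAt ℝ u r := fun r hr =>
    differentiableAt_of_deriv_ne_zero (hu' r hr).ne'
  have hu1 : ContDiffOn ℝ 1 (deriv u) I :=
    (hu.derivWithin hunique (by norm_num)).congr
      fun r hr => ((hdiff r hr).derivWithin (hunique r hr)).symm
  have hGcont : Continuous G := continuous_iff_continuousAt.2 fun t => (hG t).continuousAt
  refine strictAntiOn_of_deriv_neg hconv
    (((hu1.continuousOn.pow 2).const_mul _).add (hGcont.comp_continuousOn hu.continuousOn))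
    fun r hr => ?_
  have hrI := interior_subset hr
  have hd1 : HasDerivAt (deriv u) (deriv (deriv u) r) r :=
    ((hu1.differentiableOn (by norm_num)).differentiableAt
      (mem_interior_iff_mem_nhds.1 hr)).hasDerivAt
  have hE := ((hd1.pow 2).const_mul (c / 2)).add ((hG (u r)).comp r (hdiff r hrI).hasDerivAt)
  have hderiv : deriv (fun r => c / 2 * (deriv u r) ^ 2 + G (u r)) r
      = deriv u r * (c * deriv (deriv u) r + g (u r)) := by
    refine (HasDerivAt.deriv (f := fun r => c / 2 * (deriv u r) ^ 2 + G (u r)) hE).trans ?_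
    push_cast
    ring
  rw [hderiv]
  exact mul_neg_of_pos_of_neg (hu' r hrI) (hneg r hrI)

theorem pucci_radial_energy_decreasing_of_deriv_pos
    (lam Lam : ℝ) (hlam : 0 < lam) (hlamLam : lam ≤ Lam)
    (N : ℕ) (hN : 2 ≤ N)
    (g : ℝ → ℝ) (hg1 : LocallyLipschitz g)
    (hg2 : ∀ t, g (-t) = - g t)
    (α : ℝ) (hα : 0 < α)
    (hg3pos : ∀ t, 0 < t → t < α → 0 < g t)
    (hg3neg : ∀ t, α < t → g t < 0)
    (G : ℝ → ℝ) (hG : ∀ t, G t = ∫ s in (0:ℝ)..t, g s)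
    (I : Set ℝ) (hI : I ⊆ Set.Ioi 0) (hIconn : I.OrdConnected)
    (u : ℝ → ℝ) (hu : ContDiffOn ℝ 2 u I)
    (hode : ∀ r ∈ I,
      (if 0 ≤ deriv (deriv u) r then Lam else lam) * deriv (deriv u) r
        + ((N : ℝ) - 1) / r * ((if 0 ≤ deriv u r then Lam else lam) * deriv u r)
        + g (u r) = 0)
    (hu' : ∀ r ∈ I, 0 < deriv u r) :
    StrictAntiOn (fun r => lam / 2 * (deriv u r) ^ 2 + G (u r)) I ∧
    StrictAntiOn (fun r => Lam / 2 * (deriv u r) ^ 2 + G (u r)) I := by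
  have hGd : ∀ t, HasDerivAt G (g t) t := fun t => by
    rw [funext hG]
    exact intervalIntegral.integral_hasDerivAt_right (hg1.continuous.intervalIntegrable _ _)
      (hg1.continuous.stronglyMeasurableAtFilter _ _) hg1.continuous.continuousAt
  have hdrift : ∀ r ∈ I, 0 < ((N : ℝ) - 1) / r * (Lam * deriv u r) := fun r hr => by
    have hN1 : (0 : ℝ) < (N : ℝ) - 1 := by
      have : (2 : ℝ) ≤ N := by exact_mod_cast hN
      linarith
    exact mul_pos (div_pos hN1 (hI hr)) (mul_pos (hlam.trans_le hlamLam) (hu' r hr))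
  have hneg : ∀ r ∈ I, lam * deriv (deriv u) r + g (u r) < 0 ∧
      Lam * deriv (deriv u) r + g (u r) < 0 := fun r hr => by
    have h := hode r hr
    rw [if_pos (hu' r hr).le] at h
    have hd := hdrift r hr
    split_ifs at h with h2
    · have := mul_le_mul_of_nonneg_right hlamLam h2
      constructor <;> linarith
    · have := mul_le_mul_of_nonpos_right hlamLam (not_le.1 h2).le
      constructor <;> linarith
  exact ⟨strictAntiOn_energy_of_deriv_pos hGd hIconn hu hu' fun r hr => (hneg r hr).1,
    strictAntiOn_energy_of_deriv_pos hGd hIconn hu hu' fun r hr => (hneg r hr).2⟩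
end
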